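/- arXiv:1812.04050 — 7 statements merged into one kernel-verified Lean document; each statement's English description precedes it below -/
import Mathlib

section
/- For every n ≥ 2, the Černý automaton C_n is synchronizing and its switch count satisfies sw(C_n) = 2n − 3. -/
/-- The state reached from `q` after reading the word `w`. -/
def actWord {Q σ : Type*} (δ : Q → σ → Q) (q : Q) (w : List σ) : Q :=
  w.foldl δ q

/-- A word `w` is synchronizing for the DFA with transition function `δ`:
starting in any state, after processing `w` one always ends in the same state. -/
def IsSyncWord {Q σ : Type*} (δ : Q → σ → Q) (w : List σ) : Prop :=
  ∃ qs : Q, ∀ q : Q, actWord δ q w = qs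

/-- The switch count of a word: the number of maximal blocks of consecutive
equal symbols. -/
def swc {σ : Type*} [DecidableEq σ] : List σ → ℕ
  | [] => 0
  | [_] => 1
  | a :: b :: w => (if a = b then 0 else 1) + swc (b :: w)

/-- The switch count of a synchronizing automaton: the minimal switch count of a
synchronizing word. -/
noncomputable def swOf {Q σ : Type*} [DecidableEq σ] (δ : Q → σ → Q) : ℕ :=
  sInf {k | ∃ w : List σ, IsSyncWord δ w ∧ swc w = k}

/-- The minimal length of a synchronizing word. -/
noncomputable def sslOf {Q σ : Type*} (δ : Q → σ → Q) : ℕ :=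
  sInf {k | ∃ w : List σ, IsSyncWord δ w ∧ w.length = k}

/-- The Černý automaton `C_n` (states renumbered to `ZMod n`): symbols are
booleans, `false` (= `a`) is the cyclic symbol `q ↦ q + 1`, and `true` (= `b`)
maps `0` to `1` and fixes every other state. -/
def cernyStep (n : ℕ) : ZMod n → Bool → ZMod n := fun q s =>
  if s then (if q = 0 then 1 else q) else q + 1

theorem cernyStep_true_of_eq_zero {n : ℕ} {q : ZMod n} (h : q = 0) :
    cernyStep n q true = 1 := by
  simp [cernyStep, h]

theorem cernyStep_true_of_ne_zero {n : ℕ} {q : ZMod n} (h : q ≠ 0) :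
    cernyStep n q true = q := by
  simp [cernyStep, h]

theorem cernyStep_false {n : ℕ} (q : ZMod n) : cernyStep n q false = q + 1 := rfl

theorem cernyStep_true_true {n : ℕ} [Fact (1 < n)] (q : ZMod n) :
    cernyStep n (cernyStep n q true) true = cernyStep n q true := by
  by_cases h : q = 0
  · rw [cernyStep_true_of_eq_zero h, cernyStep_true_of_ne_zero one_ne_zero]
  · rw [cernyStep_true_of_ne_zero h, cernyStep_true_of_ne_zero h]

theorem actWord_cons {Q σ : Type*} (δ : Q → σ → Q) (q : Q) (s : σ) (w : List σ) :
    actWord δ q (s :: w) = actWord δ (δ q s) w := rfl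

theorem actWord_append {Q σ : Type*} (δ : Q → σ → Q) (q : Q) (u v : List σ) :
    actWord δ q (u ++ v) = actWord δ (actWord δ q u) v :=
  List.foldl_append

theorem actWord_cernyStep_replicate_false {n : ℕ} (k : ℕ) (q : ZMod n) :
    actWord (cernyStep n) q (List.replicate k false) = q + k := by
  induction k generalizing q with
  | zero => simp [actWord]
  | succ k ih =>
    rw [List.replicate_succ, actWord_cons, ih, cernyStep_false]
    push_cast
    ring

theorem card_le_card_image_cernyStep_true_add_one {n : ℕ} (S : Finset (ZMod n)) :
    S.card ≤ (S.image (cernyStep n · true)).card + 1 := by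
  have hsub : S.erase 0 ⊆ S.image (cernyStep n · true) := by
    intro q hq
    rw [Finset.mem_erase] at hq
    exact Finset.mem_image.2 ⟨q, hq.2, cernyStep_true_of_ne_zero hq.1⟩
  have h₁ := Finset.card_le_card hsub
  have h₂ := Finset.pred_card_le_card_erase (s := S) (a := (0 : ZMod n))
  omega

theorem image_actWord_cons {n : ℕ} (S : Finset (ZMod n)) (s : Bool) (w : List Bool) :
    S.image (actWord (cernyStep n) · (s :: w)) =
      (S.image (cernyStep n · s)).image (actWord (cernyStep n) · w) := by
  rw [Finset.image_image]
  rfl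

/-- A word beginning with `b` has `⌈k / 2⌉` blocks of `b` and one beginning with `a` has `⌊k / 2⌋`,
where `k` is the switch count; each block of `b` merges at most one pair of states. -/
theorem card_le_card_image_actWord_add {n : ℕ} [Fact (1 < n)] (s : Bool) (w : List Bool)
    (S : Finset (ZMod n)) :
    S.card ≤ (S.image (actWord (cernyStep n) · (s :: w))).card +
      (swc (s :: w) + if s then 1 else 0) / 2 := by
  have hfalse (T : Finset (ZMod n)) : (T.image (cernyStep n · false)).card = T.card :=
    Finset.card_image_of_injective _ (add_left_injective 1)
  induction w generalizing s S with
  | nil =>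
    cases s
    · exact (hfalse S).ge.trans (Nat.le_add_right _ _)
    · exact card_le_card_image_cernyStep_true_add_one S
  | cons t w ih =>
    cases s <;> cases t
    · have h := ih false (S.image (cernyStep n · false))
      rw [← image_actWord_cons, hfalse] at h
      simpa [swc] using h
    · have h := ih true (S.image (cernyStep n · false))
      rw [← image_actWord_cons, hfalse] at h
      simpa [swc, add_comm] using h
    · have hmerge := card_le_card_image_cernyStep_true_add_one S
      have h := ih false (S.image (cernyStep n · true))
      rw [← image_actWord_cons] at h
      simp only [swc, Bool.true_eq_false, Bool.false_eq_true, if_true, if_false] at h ⊢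
      omega
    · have h := ih true S
      have heq (q : ZMod n) : actWord (cernyStep n) q (true :: true :: w) =
          actWord (cernyStep n) q (true :: w) := by
        simp only [actWord_cons, cernyStep_true_true]
      simpa [swc, heq] using h

theorem le_swc_of_isSyncWord_cernyStep {n : ℕ} (hn : 2 ≤ n) {w : List Bool}
    (hw : IsSyncWord (cernyStep n) w) : 2 * n - 3 ≤ swc w := by
  have : Fact (1 < n) := ⟨hn⟩
  have : NeZero n := ⟨by omega⟩
  obtain ⟨r, hr⟩ := hw
  cases w with
  | nil => exact absurd ((hr 0).trans (hr 1).symm) zero_ne_one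
  | cons s w =>
    have h := card_le_card_image_actWord_add s w (Finset.univ : Finset (ZMod n))
    have himage : (Finset.univ.image (actWord (cernyStep n) · (s :: w))).card ≤ 1 := by
      simp only [hr]
      exact (Finset.card_le_card (Finset.image_subset_iff.2 fun _ _ =>
        Finset.mem_singleton_self r)).trans (Finset.card_singleton r).le
    rw [Finset.card_univ, ZMod.card] at h
    split_ifs at h <;> omega

/-- The word `(b a ^ (n - 1)) ^ m b`. -/
def cernyWord (n : ℕ) : ℕ → List Bool
  | 0 => [true]
  | m + 1 => true :: (List.replicate (n - 1) false ++ cernyWord n m)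

theorem swc_replicate_append {σ : Type*} [DecidableEq σ] {s t : σ} (h : s ≠ t) (k : ℕ)
    (w : List σ) : swc (List.replicate (k + 1) s ++ t :: w) = 1 + swc (t :: w) := by
  induction k with
  | zero => simp [swc, h]
  | succ k ih => simpa [List.replicate_succ, swc] using ih

theorem cernyWord_eq_cons (n m : ℕ) : ∃ w, cernyWord n m = true :: w := by
  cases m <;> exact ⟨_, rfl⟩

theorem swc_cernyWord {n : ℕ} (hn : 2 ≤ n) (m : ℕ) : swc (cernyWord n m) = 2 * m + 1 := by
  induction m with
  | zero => rfl
  | succ m ih =>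
    obtain ⟨w, hw⟩ := cernyWord_eq_cons n m
    obtain ⟨k, rfl⟩ := Nat.exists_eq_add_of_le' hn
    have h := swc_replicate_append (Bool.false_ne_true) k w
    rw [← hw, ih, List.replicate_succ, List.cons_append] at h
    rw [cernyWord, Nat.add_sub_assoc (by norm_num), List.replicate_succ, List.cons_append, swc, h]
    simp
    omega

theorem actWord_cernyWord {n : ℕ} (hn : 2 ≤ n) {m j : ℕ} (hj : j ≤ m + 1) :
    actWord (cernyStep n) (j : ZMod n) (cernyWord n m) = 1 := by
  have hcast : ((n - 1 : ℕ) : ZMod n) = -1 := by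
    rw [Nat.cast_sub (by omega)]
    simp
  induction m generalizing j with
  | zero =>
    rw [cernyWord, actWord_cons]
    interval_cases j <;> simp [actWord, cernyStep]
  | succ m ih =>
    rw [cernyWord, actWord_cons, actWord_append, actWord_cernyStep_replicate_false, hcast]
    by_cases h : (j : ZMod n) = 0
    · rw [cernyStep_true_of_eq_zero h]
      simpa using ih (Nat.zero_le _)
    · rw [cernyStep_true_of_ne_zero h]
      cases j with
      | zero => simp at h
      | succ j => simpa using ih (Nat.le_of_succ_le_succ hj)

theorem isSyncWord_cernyWord {n : ℕ} (hn : 2 ≤ n) :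
    IsSyncWord (cernyStep n) (cernyWord n (n - 2)) := by
  have : NeZero n := ⟨by omega⟩
  refine ⟨1, fun q => ?_⟩
  have hq := q.val_lt
  simpa using actWord_cernyWord hn (m := n - 2) (j := q.val) (by omega)

/-- For every `n ≥ 2`, the Černý automaton `C_n` is synchronizing and its
switch count satisfies `sw(C_n) = 2n - 3`. -/
theorem cerny_sw (n : ℕ) (hn : 2 ≤ n) :
    (∃ w : List Bool, IsSyncWord (cernyStep n) w) ∧
      swOf (cernyStep n) = 2 * n - 3 := by
  refine ⟨⟨_, isSyncWord_cernyWord hn⟩, le_antisymm ?_ ?_⟩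
  · refine Nat.sInf_le ⟨_, isSyncWord_cernyWord hn, ?_⟩
    rw [swc_cernyWord hn]
    omega
  · refine le_csInf ⟨_, _, isSyncWord_cernyWord hn, rfl⟩ ?_
    rintro _ ⟨w, hw, rfl⟩
    exact le_swc_of_isSyncWord_cernyStep hn hw
end

section
/- For every n ≥ 5, the DFA R_n is synchronizing and has switch count sw(R_n) = (n² + n)/2. -/
/-- Transitions of `R_n` described on state numbers `1,…,n` and symbol indices
`1,…,n-2`: `a_1` maps `3 ↦ 2` and swaps `2 ↔ 4`; `a_2` swaps `3 ↔ 4`;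
`a_3` swaps `1 ↔ 2` and `4 ↔ 5`; `a_4` swaps `2 ↔ 6`; for `5 ≤ i ≤ n-2`,
`a_i` swaps `i+1 ↔ i+2`; every symbol fixes all other states. -/
def Rf (i x : ℕ) : ℕ :=
  if i = 1 then (if x = 3 then 2 else if x = 2 then 4 else if x = 4 then 2 else x)
  else if i = 2 then (if x = 3 then 4 else if x = 4 then 3 else x)
  else if i = 3 then
    (if x = 1 then 2 else if x = 2 then 1 else if x = 4 then 5
      else if x = 5 then 4 else x)
  else if i = 4 then (if x = 2 then 6 else if x = 6 then 2 else x)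
  else (if x = i + 1 then i + 2 else if x = i + 2 then i + 1 else x)

/-- The automaton `R_n` (for `n ≥ 5`): states `{1,…,n}` encoded as `Fin n`
(state `x` is `⟨x-1, _⟩`) and symbols `a_1,…,a_{n-2}` encoded as `Fin (n-2)`
(symbol `a_i` is `⟨i-1, _⟩`). -/
def Rstep (n : ℕ) (hn : 5 ≤ n) : Fin n → Fin (n - 2) → Fin n := fun q s =>
  ⟨Rf ((s : ℕ) + 1) ((q : ℕ) + 1) - 1, by
    have hq := q.isLt; have hs := s.isLt
    unfold Rf; split_ifs <;> omega⟩

section SwitchCount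

variable {σ τ : Type*} [DecidableEq σ] [DecidableEq τ]

theorem swc_cons_of_head?_ne (a : σ) (w : List σ) (h : w.head? ≠ some a) :
    swc (a :: w) = 1 + swc w := by
  cases w with
  | nil => rfl
  | cons b w =>
    have hab : a ≠ b := fun hab => h (by simp [hab])
    simp [swc, hab]

theorem swc_cons_self (a : σ) (w : List σ) : swc (a :: a :: w) = swc (a :: w) := by
  simp [swc]

theorem swc_le_swc_cons (a : σ) (w : List σ) : swc w ≤ swc (a :: w) := by
  cases w with
  | nil => simp [swc]
  | cons b w => simp [swc]

theorem swc_cons_le (a : σ) (w : List σ) : swc (a :: w) ≤ 1 + swc w := by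
  cases w with
  | nil => simp [swc]
  | cons b w => simp only [swc]; split_ifs <;> omega

theorem swc_append_le (u v : List σ) : swc (u ++ v) ≤ swc u + swc v := by
  induction u with
  | nil => simp [swc]
  | cons a u ih =>
    cases u with
    | nil => simpa [swc] using swc_cons_le a v
    | cons b u =>
      simp only [List.cons_append, swc] at ih ⊢
      omega

theorem swc_map (f : σ → τ) (hf : Function.Injective f) (w : List σ) :
    swc (w.map f) = swc w := by
  induction w with
  | nil => rfl
  | cons a w ih =>
    cases w with
    | nil => rfl
    | cons b w => simpa [swc, hf.eq_iff] using ih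

end SwitchCount

/-- The word over symbol indices `1,…,n-2` described by a word over `Fin (n-2)`. -/
def symbolIndices {m : ℕ} (w : List (Fin m)) : List ℕ :=
  w.map fun s : Fin m => (s : ℕ) + 1

theorem swc_symbolIndices {m : ℕ} (w : List (Fin m)) : swc (symbolIndices w) = swc w :=
  swc_map _ (fun a b h => Fin.ext (by simpa using h)) w

theorem one_le_of_mem_symbolIndices {m : ℕ} (w : List (Fin m)) :
    ∀ i ∈ symbolIndices w, 1 ≤ i := by
  simp [symbolIndices]

theorem exists_symbolIndices_eq {m : ℕ} (w : List ℕ) (hw : ∀ i ∈ w, 1 ≤ i ∧ i ≤ m) :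
    ∃ v : List (Fin m), symbolIndices v = w := by
  induction w with
  | nil => exact ⟨[], rfl⟩
  | cons i w ih =>
    obtain ⟨v, hv⟩ := ih fun j hj => hw j (List.mem_cons_of_mem _ hj)
    obtain ⟨h1, h2⟩ := hw i List.mem_cons_self
    refine ⟨⟨i - 1, by omega⟩ :: v, ?_⟩
    simp only [symbolIndices, List.map_cons] at hv ⊢
    rw [hv, Nat.sub_add_cancel h1]

theorem one_le_Rf (i x : ℕ) (hx : 1 ≤ x) : 1 ≤ Rf i x := by
  unfold Rf; split_ifs <;> omega

theorem actWord_Rstep_add_one (n : ℕ) (hn : 5 ≤ n) (w : List (Fin (n - 2))) (q : Fin n) :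
    ((actWord (Rstep n hn) q w : Fin n) : ℕ) + 1 =
      (symbolIndices w).foldl (fun x i => Rf i x) ((q : ℕ) + 1) := by
  induction w generalizing q with
  | nil => rfl
  | cons s w ih =>
    have h : ((Rstep n hn q s : Fin n) : ℕ) + 1 = Rf ((s : ℕ) + 1) ((q : ℕ) + 1) :=
      Nat.sub_add_cancel (one_le_Rf _ _ (by omega))
    have := ih (Rstep n hn q s)
    rw [h] at this
    exact this

section LowerBound

/-- The contribution to `weight` of the set of occupied states among `1,…,5`. -/
def headWeight (A : Finset ℕ) : ℤ :=
  ([-4, 1, 1, 6, 1, 6, 7, 12, 0, 5, 6, 11, 1, 6, 7, 12,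
    -1, 5, 4, 10, 2, 8, 7, 13, 3, 9, 8, 14, 4, 10, 9, 15] : List ℤ).getD
      (∑ x ∈ A, 2 ^ (x - 1)) 0

/-- A potential on sets of states of `R_n` which drops by at most one under every block
of equal symbols. -/
def weight (S : Finset ℕ) : ℤ :=
  headWeight (S ∩ Finset.Icc 1 5) + ∑ x ∈ S with 6 ≤ x, (x : ℤ)

theorem weight_le_of_head {f : ℕ → ℕ} (S : Finset ℕ) (hf : ∀ x ∉ Finset.Icc 1 5, f x = x)
    (hf' : ∀ x ∈ Finset.Icc 1 5, f x ∈ Finset.Icc 1 5)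
    (h : ∀ A ∈ (Finset.Icc 1 5).powerset, headWeight A ≤ 1 + headWeight (A.image f)) :
    weight S ≤ 1 + weight (S.image f) := by
  have h1 : S.image f ∩ Finset.Icc 1 5 = (S ∩ Finset.Icc 1 5).image f := by
    ext y
    simp only [Finset.mem_inter, Finset.mem_image]
    constructor
    · rintro ⟨⟨x, hx, rfl⟩, hy⟩
      refine ⟨x, ⟨hx, ?_⟩, rfl⟩
      by_contra hx'
      rw [hf x hx'] at hy
      exact hx' hy
    · rintro ⟨x, ⟨hx, hx'⟩, rfl⟩
      exact ⟨⟨x, hx, rfl⟩, hf' x hx'⟩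
  have h2 : {x ∈ S.image f | 6 ≤ x} = {x ∈ S | 6 ≤ x} := by
    ext y
    simp only [Finset.mem_filter, Finset.mem_image]
    constructor
    · rintro ⟨⟨x, hx, rfl⟩, hy⟩
      by_cases hx' : x ∈ Finset.Icc 1 5
      · have := Finset.mem_Icc.1 (hf' x hx')
        omega
      · rw [hf x hx'] at hy ⊢
        exact ⟨hx, hy⟩
    · rintro ⟨hy, hy'⟩
      exact ⟨⟨y, hy, hf y (by simp only [Finset.mem_Icc]; omega)⟩, hy'⟩
  have h3 := h (S ∩ Finset.Icc 1 5) (Finset.mem_powerset.2 Finset.inter_subset_right)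
  unfold weight
  rw [h1, h2]
  omega

theorem Rf_swap (i : ℕ) (hi : 4 ≤ i) :
    ∃ a b, Rf i = Equiv.swap a b ∧ 6 ≤ b ∧ (i = 4 ∧ a = 2 ∧ b = 6 ∨ 6 ≤ a ∧ b = a + 1) := by
  rcases hi.eq_or_lt with rfl | hi
  · refine ⟨2, 6, ?_, le_rfl, by simp⟩
    ext x
    simp only [Rf, Equiv.swap_apply_def]
    norm_num
  · refine ⟨i + 1, i + 2, ?_, by omega, by omega⟩
    ext x
    simp only [Rf, Equiv.swap_apply_def]
    split_ifs <;> omega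

theorem image_swap_of_mem {S : Finset ℕ} {a b : ℕ} (ha : a ∈ S) (hb : b ∉ S) :
    S.image (Equiv.swap a b) = insert b (S.erase a) := by
  have hab : a ≠ b := fun h => hb (h ▸ ha)
  ext y
  simp only [Finset.mem_image, Finset.mem_insert, Finset.mem_erase]
  constructor
  · rintro ⟨x, hx, rfl⟩
    rw [Equiv.swap_apply_def]
    split_ifs with h1 h2
    · simp
    · exact absurd (h2 ▸ hx) hb
    · exact Or.inr ⟨h1, hx⟩
  · rintro (rfl | ⟨h1, h2⟩)
    · exact ⟨a, ha, Equiv.swap_apply_left _ _⟩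
    · exact ⟨y, h2, Equiv.swap_apply_of_ne_of_ne h1 fun h => hb (h ▸ h2)⟩

theorem image_swap_of_iff {S : Finset ℕ} {a b : ℕ} (h : a ∈ S ↔ b ∈ S) :
    S.image (Equiv.swap a b) = S := by
  have hsub : S.image (Equiv.swap a b) ⊆ S := by
    intro y hy
    obtain ⟨x, hx, rfl⟩ := Finset.mem_image.1 hy
    rw [Equiv.swap_apply_def]
    split_ifs with h1 h2
    · exact h.1 (h1 ▸ hx)
    · exact h.2 (h2 ▸ hx)
    · exact hx
  exact Finset.eq_of_subset_of_card_le hsub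
    (Finset.card_image_of_injective _ (Equiv.injective _)).ge

theorem headWeight_erase_two : ∀ A ∈ (Finset.Icc 1 5).powerset, 2 ∈ A →
    headWeight A ≤ 7 + headWeight (A.erase 2) ∧
      headWeight (A.erase 2) + 5 ≤ headWeight A := by
  decide +kernel

/-- Moving a token from state `a` to the free state `b` along an edge of the tail changes the
weight by at most one. -/
theorem abs_weight_move {S : Finset ℕ} {a b : ℕ} (hb : 6 ≤ b)
    (hab : a = 2 ∧ b = 6 ∨ 6 ≤ a ∧ b = a + 1) (ha : a ∈ S) (hbS : b ∉ S) :
    |weight (insert b (S.erase a)) - weight S| ≤ 1 := by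
  have htail : ∀ T : Finset ℕ, b ∉ T →
      ∑ x ∈ insert b T with 6 ≤ x, (x : ℤ) = b + ∑ x ∈ T with 6 ≤ x, (x : ℤ) := by
    intro T hT
    rw [Finset.filter_insert, if_pos hb, Finset.sum_insert (by simp [hT])]
  have hhead : ∀ T : Finset ℕ, insert b T ∩ Finset.Icc 1 5 = T ∩ Finset.Icc 1 5 := fun T =>
    Finset.insert_inter_of_notMem (by simp only [Finset.mem_Icc]; omega)
  have hbe : b ∉ S.erase a := fun h => hbS (Finset.mem_of_mem_erase h)
  unfold weight
  rw [hhead, htail _ hbe, Finset.erase_inter, Finset.filter_erase]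
  rcases hab with ⟨rfl, rfl⟩ | ⟨ha6, rfl⟩
  · have h1 : 2 ∉ ({x ∈ S | 6 ≤ x} : Finset ℕ) := by simp
    rw [Finset.erase_eq_of_notMem h1]
    obtain ⟨h2, h3⟩ := headWeight_erase_two (S ∩ Finset.Icc 1 5)
      (Finset.mem_powerset.2 Finset.inter_subset_right) (by simp [ha])
    rw [abs_le]
    push_cast
    constructor <;> linarith
  · have h1 : a ∉ S ∩ Finset.Icc 1 5 := by
      simp only [Finset.mem_inter, Finset.mem_Icc]
      omega
    have h2 : a ∈ ({x ∈ S | 6 ≤ x} : Finset ℕ) := by simp [ha, ha6]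
    rw [Finset.erase_eq_of_notMem h1, ← Finset.add_sum_erase _ _ h2, abs_le]
    push_cast
    constructor <;> linarith

theorem weight_le_of_swap {a b : ℕ} (S : Finset ℕ) (hb : 6 ≤ b)
    (hab : a = 2 ∧ b = 6 ∨ 6 ≤ a ∧ b = a + 1) :
    weight S ≤ 1 + weight (S.image (Equiv.swap a b)) := by
  by_cases h : a ∈ S ↔ b ∈ S
  · rw [image_swap_of_iff h]
    omega
  by_cases ha : a ∈ S
  · have hbS : b ∉ S := fun hbS => h (by simp [ha, hbS])
    rw [image_swap_of_mem ha hbS]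
    have := (abs_le.1 (abs_weight_move hb hab ha hbS)).1
    omega
  · have hbS : b ∈ S := by
      by_contra hbS
      exact h (by simp [ha, hbS])
    have hne : a ≠ b := fun h => ha (h ▸ hbS)
    rw [Equiv.swap_comm, image_swap_of_mem hbS ha]
    have := (abs_le.1 (abs_weight_move (S := insert a (S.erase b)) hb hab (by simp)
      (by simp [hne.symm]))).2
    rw [Finset.erase_insert (by simp [ha]), Finset.insert_erase hbS] at this
    omega

theorem weight_le_image_Rf (i : ℕ) (hi : 1 ≤ i) (S : Finset ℕ) :
    weight S ≤ 1 + weight (S.image (Rf i)) := by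
  by_cases h4 : 4 ≤ i
  · obtain ⟨a, b, hab, hb, h⟩ := Rf_swap i h4
    rw [hab]
    exact weight_le_of_swap S hb (h.imp_left And.right)
  · have hfix : ∀ x ∉ Finset.Icc 1 5, Rf i x = x := by
      intro x hx
      rw [Finset.mem_Icc] at hx
      unfold Rf; split_ifs <;> omega
    refine weight_le_of_head S hfix ?_ ?_ <;> interval_cases i <;> decide +kernel

theorem weight_le_image_Rf_one_sq (S : Finset ℕ) :
    weight S ≤ 1 + weight (S.image (Rf 1 ∘ Rf 1)) := by
  refine weight_le_of_head S ?_ (by decide +kernel) (by decide +kernel)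
  intro x hx
  rw [Finset.mem_Icc] at hx
  have h : Rf 1 x = x := by unfold Rf; split_ifs <;> omega
  simp [h]

/-- A set collapsed to a point by a map identifying at most the states `3` and `4` has
weight one, so a bound on the weight after the map yields one before it. -/
theorem weight_le_one_add {f : ℕ → ℕ} {S : Finset ℕ} {k : ℕ} (hS : 1 < S.card)
    (hf : ∀ x y, x ≠ y → f x = f y → x = 3 ∨ x = 4) (hw : weight S ≤ 1 + weight (S.image f))
    (hk : 1 < (S.image f).card → weight (S.image f) ≤ k) : weight S ≤ (1 + k : ℕ) := by
  push_cast
  by_cases hc : 1 < (S.image f).card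
  · linarith [hk hc]
  · have hsub : S ⊆ {3, 4} := by
      intro x hx
      obtain ⟨y, hy, hyx⟩ := Finset.exists_mem_ne hS x
      have := Finset.card_le_one.1 (not_lt.1 hc) (f x) (Finset.mem_image_of_mem f hx) (f y)
        (Finset.mem_image_of_mem f hy)
      simpa using hf x y hyx.symm this
    have hS34 : S = {3, 4} := Finset.eq_of_subset_of_card_le hsub (by simpa using Nat.succ_le_of_lt hS)
    have h1 : weight {3, 4} = 1 := by decide +kernel
    rw [hS34, h1]
    omega

theorem Rf_collapse (i : ℕ) (hi : 1 ≤ i) (x y : ℕ) (hxy : x ≠ y) (h : Rf i x = Rf i y) :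
    x = 3 ∨ x = 4 := by
  unfold Rf at h
  split_ifs at h <;> omega

theorem Rf_one_sq_collapse (x y : ℕ) (hxy : x ≠ y) (h : (Rf 1 ∘ Rf 1) x = (Rf 1 ∘ Rf 1) y) :
    x = 3 ∨ x = 4 := by
  simp only [Function.comp, Rf, if_true] at h
  split_ifs at h <;> omega

theorem Rf_Rf_of_two_le (i : ℕ) (hi : 2 ≤ i) : Rf i ∘ Rf i = id := by
  by_cases h4 : 4 ≤ i
  · obtain ⟨a, b, hab, -⟩ := Rf_swap i h4
    funext x
    simp [hab]
  · funext x
    interval_cases i <;> simp only [Function.comp, Rf, id] <;> norm_num <;> split_ifs <;> omega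

theorem Rf_one_cube : Rf 1 ∘ Rf 1 ∘ Rf 1 = Rf 1 := by
  funext x
  simp only [Function.comp, Rf, if_true]
  split_ifs <;> omega

theorem weight_le_swc (w : List ℕ) (hw : ∀ i ∈ w, 1 ≤ i) (S : Finset ℕ) (hS : 1 < S.card)
    (h : (w.foldl (fun T i => T.image (Rf i)) S).card ≤ 1) : weight S ≤ swc w := by
  match w with
  | [] => exact absurd h (not_le.2 hS)
  | a :: w =>
    have ha : 1 ≤ a := hw a List.mem_cons_self
    by_cases hhead : w.head? = some a
    · obtain ⟨w, rfl⟩ : ∃ v, w = a :: v := by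
        cases w with
        | nil => simp at hhead
        | cons b v => exact ⟨v, by simpa using hhead⟩
      rcases ha.eq_or_lt with rfl | ha2
      · by_cases hhead' : w.head? = some 1
        · obtain ⟨w, rfl⟩ : ∃ v, w = 1 :: v := by
            cases w with
            | nil => simp at hhead'
            | cons b v => exact ⟨v, by simpa using hhead'⟩
          rw [swc_cons_self, swc_cons_self]
          refine weight_le_swc (1 :: w) (fun i hi => hw i (by simp_all)) S hS ?_
          simpa only [List.foldl_cons, Finset.image_image, Rf_one_cube] using h
        · rw [swc_cons_self, swc_cons_of_head?_ne _ _ hhead']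
          refine weight_le_one_add hS Rf_one_sq_collapse (weight_le_image_Rf_one_sq S) fun hc =>
            weight_le_swc w (fun i hi => hw i (by simp_all)) _ hc ?_
          simpa only [List.foldl_cons, Finset.image_image] using h
      · have hle : swc w ≤ swc (a :: a :: w) :=
          (swc_le_swc_cons a w).trans (swc_le_swc_cons a _)
        refine le_trans (weight_le_swc w (fun i hi => hw i (by simp_all)) S hS ?_)
          (Int.ofNat_le.2 hle)
        simpa only [List.foldl_cons, Finset.image_image, Rf_Rf_of_two_le a ha2,
          Finset.image_id] using h
    · rw [swc_cons_of_head?_ne _ _ hhead]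
      exact weight_le_one_add hS (Rf_collapse a ha) (weight_le_image_Rf a ha S) fun hc =>
        weight_le_swc w (fun i hi => hw i (by simp_all)) _ hc h
termination_by w.length

theorem foldl_image_Rf (w : List ℕ) (S : Finset ℕ) :
    w.foldl (fun T i => T.image (Rf i)) S = S.image fun x => w.foldl (fun x i => Rf i x) x := by
  induction w generalizing S with
  | nil => simp
  | cons i w ih =>
    rw [List.foldl_cons, ih, Finset.image_image]
    rfl

theorem weight_Icc (n : ℕ) (hn : 5 ≤ n) : weight (Finset.Icc 1 n) = ((n ^ 2 + n) / 2 : ℕ) := by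
  have key : 2 * weight (Finset.Icc 1 n) = (n ^ 2 + n : ℕ) := by
    induction n, hn using Nat.le_induction with
    | base => decide +kernel
    | succ n hn ih =>
      have hw : weight (Finset.Icc 1 (n + 1)) = weight (Finset.Icc 1 n) + (n + 1) := by
        have hIcc : Finset.Icc 1 (n + 1) = insert (n + 1) (Finset.Icc 1 n) :=
          (Finset.insert_Icc_right_eq_Icc_succ (by simp)).symm
        unfold weight
        rw [hIcc, Finset.insert_inter_of_notMem (by simp only [Finset.mem_Icc]; omega),
          Finset.filter_insert, if_pos (by omega), Finset.sum_insert (by simp)]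
        push_cast
        ring
      rw [hw, mul_add, ih]
      push_cast
      ring
  omega

theorem le_swc_of_isSyncWord (n : ℕ) (hn : 5 ≤ n) (w : List (Fin (n - 2)))
    (hw : IsSyncWord (Rstep n hn) w) : (n ^ 2 + n) / 2 ≤ swc w := by
  obtain ⟨qs, hqs⟩ := hw
  have h := weight_le_swc (symbolIndices w) (one_le_of_mem_symbolIndices w) (Finset.Icc 1 n)
    (by simp only [Nat.card_Icc]; omega) ?_
  · rw [weight_Icc n hn, swc_symbolIndices] at h
    exact_mod_cast h
  · have hmem : ∀ x ∈ Finset.Icc 1 n,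
        (symbolIndices w).foldl (fun x i => Rf i x) x = (qs : ℕ) + 1 := by
      intro x hx
      obtain ⟨h1, h2⟩ := Finset.mem_Icc.1 hx
      have := actWord_Rstep_add_one n hn w ⟨x - 1, by omega⟩
      rw [hqs, Nat.sub_add_cancel h1] at this
      exact this.symm
    rw [foldl_image_Rf, Finset.card_le_one]
    simp only [Finset.mem_image]
    rintro _ ⟨x, hx, rfl⟩ _ ⟨y, hy, rfl⟩
    rw [hmem x hx, hmem y hy]

end LowerBound

section UpperBound

/-- Some word over the symbol indices `1,…,n-2` with switch count at most `k` maps all states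
in `S` into `T`. -/
def Drives (n : ℕ) (S T : Set ℕ) (k : ℕ) : Prop :=
  ∃ w : List ℕ, (∀ i ∈ w, 1 ≤ i ∧ i ≤ n - 2) ∧ swc w ≤ k ∧
    ∀ x ∈ S, w.foldl (fun x i => Rf i x) x ∈ T

theorem Drives.trans {n : ℕ} {S T U : Set ℕ} {k l : ℕ} (h : Drives n S T k)
    (h' : Drives n T U l) : Drives n S U (k + l) := by
  obtain ⟨u, hu, huk, huT⟩ := h
  obtain ⟨v, hv, hvl, hvU⟩ := h'
  refine ⟨u ++ v, ?_, (swc_append_le u v).trans (by omega), fun x hx => ?_⟩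
  · intro i hi
    exact (List.mem_append.1 hi).elim (hu i) (hv i)
  · rw [List.foldl_append]
    exact hvU _ (huT x hx)

theorem Drives.symbol {n : ℕ} {S T : Set ℕ} (i : ℕ) (hi : 1 ≤ i) (hin : i ≤ n - 2)
    (h : ∀ x ∈ S, Rf i x ∈ T) : Drives n S T 1 :=
  ⟨[i], by simp [hi, hin], by simp [swc], h⟩

/-- The states `1,…,k` other than `3` and `a`. -/
def statesExcept (k a : ℕ) : Set ℕ := {x | 1 ≤ x ∧ x ≤ k ∧ x ≠ 3 ∧ x ≠ a}

theorem drives_hole_out {n k j : ℕ} (hkn : k ≤ n) (hj : 6 ≤ j) (hjk : j ≤ k) :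
    Drives n (statesExcept k 3) (statesExcept k j) j := by
  induction j, hj using Nat.le_induction with
  | base =>
    refine ⟨[2, 3, 1, 3, 1, 4], by simp; omega, by simp [swc], ?_⟩
    rintro x ⟨h1, h2, h3, -⟩
    by_cases hx : x ≤ 6
    · interval_cases x <;> simp [Rf, statesExcept] at h3 ⊢ <;> omega
    · have hfix : ∀ i, 1 ≤ i → i ≤ 4 → Rf i x = x := by
        intro i hi hi'
        unfold Rf; split_ifs <;> omega
      simp only [List.foldl_cons, List.foldl_nil, hfix _ _ _, Nat.one_le_ofNat, le_refl,
        Nat.reduceLeDiff]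
      exact ⟨h1, h2, h3, by omega⟩
  | succ j hj ih =>
    refine (ih (by omega)).trans (Drives.symbol (j - 1) (by omega) (by omega) ?_)
    rintro x ⟨h1, h2, h3, h4⟩
    simp only [statesExcept, Set.mem_ofPred_eq, Rf]
    split_ifs <;> omega

theorem drives_five (n : ℕ) (hn : 5 ≤ n) : Drives n (statesExcept 5 3) {2} 14 := by
  refine ⟨[2, 3, 1, 3, 1, 3, 2, 3, 1, 1, 3, 1, 2, 3, 1], by simp; omega, by simp [swc], ?_⟩
  rintro x ⟨h1, h2, h3, -⟩
  interval_cases x <;> simp [Rf] at h3 ⊢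

theorem drives_singleton {n k : ℕ} (hk : 5 ≤ k) (hkn : k ≤ n) :
    Drives n (statesExcept k 3) {2} ((k ^ 2 + k) / 2 - 1) := by
  induction k, hk using Nat.le_induction with
  | base => exact drives_five n hkn
  | succ k hk ih =>
    have hout := drives_hole_out (j := k + 1) hkn (by omega) le_rfl
    have hset : statesExcept (k + 1) (k + 1) = statesExcept k 3 := by
      ext x
      simp only [statesExcept, Set.mem_ofPred_eq]
      omega
    rw [hset] at hout
    have hcount : ((k + 1) ^ 2 + (k + 1)) / 2 - 1 = k + 1 + ((k ^ 2 + k) / 2 - 1) := by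
      have : (k + 1) ^ 2 + (k + 1) = k ^ 2 + k + 2 * (k + 1) := by ring
      have : 2 ≤ k ^ 2 + k := by nlinarith
      omega
    rw [hcount]
    exact hout.trans (ih (by omega))

theorem exists_sync_word (n : ℕ) (hn : 5 ≤ n) :
    ∃ w : List (Fin (n - 2)), IsSyncWord (Rstep n hn) w ∧ swc w ≤ (n ^ 2 + n) / 2 := by
  have hfirst : Drives n {x | 1 ≤ x ∧ x ≤ n} (statesExcept n 3) 1 := by
    refine Drives.symbol 1 le_rfl (by omega) ?_
    rintro x ⟨h1, h2⟩
    simp only [statesExcept, Set.mem_ofPred_eq, Rf]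
    split_ifs <;> omega
  obtain ⟨w, hw, hk, hmap⟩ := hfirst.trans (drives_singleton hn le_rfl)
  obtain ⟨v, rfl⟩ := exists_symbolIndices_eq w hw
  refine ⟨v, ⟨⟨1, by omega⟩, fun q => Fin.ext ?_⟩, ?_⟩
  · have hq : (q : ℕ) + 1 ∈ {x | 1 ≤ x ∧ x ≤ n} := ⟨by omega, by omega⟩
    have h : (symbolIndices v).foldl (fun x i => Rf i x) ((q : ℕ) + 1) = 2 := hmap _ hq
    have := actWord_Rstep_add_one n hn v q
    rw [h] at this
    simpa using this
  · rw [swc_symbolIndices] at hk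
    have : 2 ≤ n ^ 2 + n := by nlinarith
    omega

end UpperBound

/-- For every `n ≥ 5`, the automaton `R_n` is synchronizing and has switch
count `(n² + n)/2`. -/
theorem R_sync_sw (n : ℕ) (hn : 5 ≤ n) :
    (∃ w : List (Fin (n - 2)), IsSyncWord (Rstep n hn) w) ∧
      swOf (Rstep n hn) = (n ^ 2 + n) / 2 := by
  obtain ⟨w, hw, hle⟩ := exists_sync_word n hn
  refine ⟨⟨w, hw⟩, le_antisymm (le_trans (Nat.sInf_le ?_) hle) ?_⟩
  · exact ⟨w, hw, rfl⟩
  refine le_csInf ⟨_, w, hw, rfl⟩ ?_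
  rintro k ⟨v, hv, rfl⟩
  exact le_swc_of_isSyncWord n hn v hv
end

section
/- For every k ≥ 2, every synchronizing word w' of the Černý automaton C_k (written over the symbols b and c, where c is the cyclic symbol) contains at least (k−1)(k−2) occurrences of the symbol c. -/
/-- If the image of `w` misses the `m + 1` cyclically consecutive states ending at `e`, then
`w` contains at least `(k - 1) * m + e` occurrences of the cyclic symbol. -/
theorem le_count_of_forall_actWord_ne {k : ℕ} (hk : 0 < k) (w : List Bool) (m e : ℕ) (he : e < k)
    (h : ∀ q : ZMod k, ∀ j ≤ m, actWord (cernyStep k) q w ≠ (e : ZMod k) - (j : ZMod k)) :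
    (k - 1) * m + e ≤ w.count false := by
  induction w using List.reverseRecOn generalizing m e with
  | nil => exact absurd (by simp [actWord]) (h e 0 (Nat.zero_le m))
  | append_singleton w s ih =>
    have hstep : ∀ q, actWord (cernyStep k) q (w ++ [s]) =
        cernyStep k (actWord (cernyStep k) q w) s := fun q => by simp [actWord]
    have hlast : (((k - 1 : ℕ)) : ZMod k) = -1 := by
      rw [Nat.cast_sub hk]; simp
    simp only [hstep] at h
    rw [List.count_append]
    cases s with
    | false =>
      simp only [cernyStep, Bool.false_eq_true, if_false] at h
      rcases e with _ | e
      · have := ih m (k - 1) (by omega) fun q j hj hq => h q j hj (by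
          rw [hq, hlast]; push_cast; ring)
        simp
        omega
      · have := ih m e (by omega) fun q j hj hq => h q j hj (by
          rw [hq]; push_cast; ring)
        simp
        omega
    | true =>
      simp only [cernyStep, if_true] at h
      rcases e with _ | e
      · rcases m with _ | m
        · simp
        · have := ih m (k - 1) (by omega) fun q j hj hq => by
            by_cases h0 : actWord (cernyStep k) q w = 0
            · refine h q j (by omega) ?_
              rw [if_pos h0]
              rw [h0, hlast] at hq
              push_cast
              linear_combination hq
            · refine h q (j + 1) (by omega) ?_
              rw [if_neg h0, hq, hlast]
              push_cast
              ring
          rw [Nat.mul_succ]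
          simp
          omega
      · have := ih m (e + 1) he fun q j hj hq => by
          by_cases h0 : actWord (cernyStep k) q w = 0
          · rcases j with _ | j
            · rw [h0, Nat.cast_zero, sub_zero] at hq
              have := Nat.le_of_dvd e.succ_pos ((ZMod.natCast_eq_zero_iff _ _).1 hq.symm)
              omega
            · refine h q j (by omega) ?_
              rw [if_pos h0]
              rw [h0] at hq
              push_cast at hq ⊢
              linear_combination hq
          · exact h q j hj (by rw [if_neg h0, hq])
        simpa using this

/-- For every `k ≥ 2`, every synchronizing word of the Černý automaton `C_k`
(over the symbols `b` = `true` and the cyclic symbol `c` = `false`) contains at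
least `(k-1)(k-2)` occurrences of the cyclic symbol `c`. -/
theorem cerny_count_cyclic (k : ℕ) (hk : 2 ≤ k) (w : List Bool)
    (hw : IsSyncWord (cernyStep k) w) :
    (k - 1) * (k - 2) ≤ w.count false := by
  obtain ⟨qs, hqs⟩ := hw
  have : NeZero k := ⟨by omega⟩
  refine (Nat.le_add_right _ _).trans <|
    le_count_of_forall_actWord_ne (by omega) w (k - 2) (qs - 1).val (ZMod.val_lt _) ?_
  intro q j hj hq
  rw [hqs, ZMod.natCast_zmod_val] at hq
  have hj0 : ((j + 1 : ℕ) : ZMod k) = 0 := by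
    push_cast
    linear_combination hq
  have := Nat.le_of_dvd j.succ_pos ((ZMod.natCast_eq_zero_iff _ _).1 hj0)
  omega
end

section
/- Let n be divisible by 6, let A ⊆ C and let w ∈ {a,b}* be a word, acting in ℬ_n. If n ∈ Aw, then Aw ⊆ C; if −n ∈ Aw, then Aw ⊆ −C. -/
/-- Transitions of the automaton `ℬ_n` on the positive states `1,…,n`.
The symbols are booleans: `false` is `a`, `true` is `b`. -/
def BposStep (n : ℕ) (q : ℤ) (s : Bool) : ℤ :=
  if s then
    (if q = 1 then 2 else if q = (n : ℤ) then -((n : ℤ) / 3)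
      else if q % 2 = 0 then q - 1 else q + 1)
  else
    (if q = 1 then -1 else if q = (n : ℤ) then -((n : ℤ) / 3)
      else if q % 2 = 0 then q + 1 else q - 1)

/-- Transitions of the auxiliary automaton `ℬ_n`, with state set
`{-n,…,-1} ∪ {1,…,n}` inside `ℤ` and symbols `false` (= `a`), `true` (= `b`);
negative states move symmetrically: `(-q)s = -(qs)`. -/
def Bstep (n : ℕ) (q : ℤ) (s : Bool) : ℤ :=
  if 0 < q then BposStep n q s else -(BposStep n (-q) s)

/-- The state reached from `q` after reading the word `w` in `ℬ_n`. -/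
def Bact (n : ℕ) (q : ℤ) (w : List Bool) : ℤ := w.foldl (Bstep n) q

/-- The image of a set of states of `ℬ_n` under the action of a word. -/
def BactSet (n : ℕ) (A : Set ℤ) (w : List Bool) : Set ℤ :=
  (fun q => Bact n q w) '' A

/-- The set `S = {2k : 1 ≤ k ≤ n/2} ∪ {-(2k-1) : 1 ≤ k ≤ n/2}`. -/
def SetS (n : ℕ) : Set ℤ :=
  {q | (0 < q ∧ q ≤ (n : ℤ) ∧ q % 2 = 0) ∨ (-(n : ℤ) < q ∧ q < 0 ∧ q % 2 = 1)}

/-- The cycle `C = [-n/3 + 1, n]`, the interval in `S` of states `q` with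
`-n/3 + 1 ≤ q ≤ n`. -/
def SetC (n : ℕ) : Set ℤ := {q ∈ SetS n | -((n : ℤ) / 3) + 1 ≤ q}

/-- The action of the word `ab` in `ℬ_n`. -/
def rotAB (n : ℕ) (q : ℤ) : ℤ := Bstep n (Bstep n q false) true

/-- `p ≃ q` iff `p(ab)^{n/3} = q(ab)^{n/3}`. -/
def simeqB (n : ℕ) (p q : ℤ) : Prop :=
  (rotAB n)^[n / 3] p = (rotAB n)^[n / 3] q

/-- Distance from `p` to `q` for `p, q ∈ S`: the least `k ≥ 1` with
`p(ab)^{n/3 + k} = q(ab)^{n/3}`. -/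
noncomputable def dpos (n : ℕ) (p q : ℤ) : ℕ :=
  sInf {k : ℕ | 1 ≤ k ∧ (rotAB n)^[n / 3 + k] p = (rotAB n)^[n / 3] q}

open Classical in
/-- Distance between states of `ℬ_n`: for `p, q ∈ S` it is `dpos`, for
`p, q ∈ -S` it is defined by `d(p,q) = d(-q,-p)`. -/
noncomputable def dB (n : ℕ) (p q : ℤ) : ℕ :=
  if p ∈ SetS n then dpos n p q else dpos n (-q) (-p)

/-- The measure `μ(A) = max_{p ∈ A} min_{q ∈ A} d(p,q)`. -/
noncomputable def muB (n : ℕ) (A : Set ℤ) : ℕ :=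
  sSup ((fun p => sInf ((fun q => dB n p q) '' A)) '' A)

/-- The states of `S` whose index, in increasing order starting from `0`, lies in the interval
`[x, x + 2n/3)`. -/
def window (n : ℕ) (x : ℤ) : Set ℤ :=
  {q | ∃ i, x ≤ i ∧ i < x + 2 * ((n : ℤ) / 3) ∧
    q = if 2 * i < n then 2 * i + 1 - n else 2 * i + 2 - n}

/-- `B` lies in a translate of `C` inside `S`, or in the negative of one. -/
def InWindow (n : ℕ) (B : Set ℤ) : Prop :=
  ∃ x : ℤ, 0 ≤ x ∧ x ≤ (n : ℤ) / 3 ∧ (B ⊆ window n x ∨ ∀ q ∈ B, -q ∈ window n x)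

theorem Bstep_neg (n : ℕ) {q : ℤ} (hq : q ≠ 0) (s : Bool) : Bstep n (-q) s = -Bstep n q s := by
  unfold Bstep
  split_ifs <;> first | omega | simp

theorem ne_zero_of_mem_window {n : ℕ} (hn : 6 ∣ n) {x q : ℤ} (hq : q ∈ window n x) : q ≠ 0 := by
  obtain ⟨i, -, -, rfl⟩ := hq
  split_ifs <;> omega

theorem neg_Bstep_mem_window {n : ℕ} (hn : 6 ∣ n) {x q : ℤ} (hx0 : 0 ≤ x)
    (hx : x ≤ (n : ℤ) / 3) (hq : q ∈ window n x) (s : Bool) :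
    -Bstep n q s ∈ window n
      (if s then (n : ℤ) / 3 - x else max ((n : ℤ) / 3 - x - 1) 0) := by
  obtain ⟨k, rfl⟩ := hn
  obtain ⟨i, hi, hi', rfl⟩ := hq
  have hdiv : ((6 * k : ℕ) : ℤ) / 3 = 2 * k := by omega
  rw [hdiv] at *
  by_cases htop : i = 6 * k - 1
  · refine ⟨4 * k - 1, by grind, by grind, ?_⟩
    cases s <;> simp only [Bstep, BposStep] <;> simp <;> grind
  · refine ⟨if s then 6 * k - 1 - i else 6 * k - 2 - i, by grind, by grind, ?_⟩
    cases s <;> simp only [Bstep, BposStep] <;> simp <;> grind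

theorem InWindow.image_Bstep {n : ℕ} (hn : 6 ∣ n) {B : Set ℤ} (hB : InWindow n B) (s : Bool) :
    InWindow n ((fun q => Bstep n q s) '' B) := by
  obtain ⟨x, hx0, hx, h⟩ := hB
  refine ⟨if s then (n : ℤ) / 3 - x else max ((n : ℤ) / 3 - x - 1) 0, ?_, ?_, ?_⟩
  · split_ifs <;> omega
  · split_ifs <;> omega
  · rcases h with h | h
    · right
      rintro _ ⟨q, hq, rfl⟩
      exact neg_Bstep_mem_window hn hx0 hx (h hq) s
    · left
      rintro _ ⟨q, hq, rfl⟩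
      have hmem := neg_Bstep_mem_window hn hx0 hx (h q hq) s
      rwa [← Bstep_neg n (ne_zero_of_mem_window hn (h q hq)), neg_neg] at hmem

theorem InWindow.BactSet {n : ℕ} (hn : 6 ∣ n) {B : Set ℤ} (hB : InWindow n B) (w : List Bool) :
    InWindow n (BactSet n B w) := by
  induction w generalizing B with
  | nil => simpa [_root_.BactSet, Bact] using hB
  | cons s w ih =>
    have := ih (hB.image_Bstep hn s)
    rwa [_root_.BactSet, Set.image_image] at this

theorem window_eq_SetC {n : ℕ} (hn : 6 ∣ n) : window n ((n : ℤ) / 3) = SetC n := by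
  ext q
  simp only [window, SetC, SetS, Set.mem_ofPred_eq]
  constructor
  · rintro ⟨i, hi, hi', rfl⟩
    split_ifs <;> omega
  · rintro ⟨h | h, hq⟩
    · exact ⟨(q + n - 2) / 2, by omega, by omega, by split_ifs <;> omega⟩
    · exact ⟨(q + n - 1) / 2, by omega, by omega, by split_ifs <;> omega⟩

theorem eq_of_natCast_mem_window {n : ℕ} (hn : 6 ∣ n) {x : ℤ}
    (hx : x ≤ (n : ℤ) / 3) (h : (n : ℤ) ∈ window n x) : x = (n : ℤ) / 3 := by
  obtain ⟨i, hi, hi', h⟩ := h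
  split_ifs at h <;> omega

theorem neg_natCast_notMem_window {n : ℕ} (hn : 6 ∣ n) {x : ℤ} (hx0 : 0 ≤ x) :
    -(n : ℤ) ∉ window n x := by
  rintro ⟨i, hi, hi', h⟩
  split_ifs at h <;> omega

/-- Lemma: for `n` divisible by 6, `A ⊆ C` and a word `w` acting in `ℬ_n`:
if `n ∈ Aw` then `Aw ⊆ C`, and if `-n ∈ Aw` then `Aw ⊆ -C`. -/
theorem subset_C_of_mem (n : ℕ) (hn : 6 ∣ n) (A : Set ℤ) (hA : A ⊆ SetC n)
    (w : List Bool) :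
    ((n : ℤ) ∈ BactSet n A w → BactSet n A w ⊆ SetC n) ∧
    (-(n : ℤ) ∈ BactSet n A w → BactSet n A w ⊆ Neg.neg '' SetC n) := by
  have hw : InWindow n (BactSet n A w) :=
    InWindow.BactSet hn ⟨(n : ℤ) / 3, by omega, le_rfl,
      .inl (hA.trans (window_eq_SetC hn).ge)⟩ w
  obtain ⟨x, hx0, hx, h | h⟩ := hw
  · refine ⟨fun hmem => ?_, fun hmem => absurd (h hmem) (neg_natCast_notMem_window hn hx0)⟩
    rwa [eq_of_natCast_mem_window hn hx (h hmem), window_eq_SetC hn] at h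
  · refine ⟨fun hmem => absurd (h _ hmem) (neg_natCast_notMem_window hn hx0),
      fun hmem q hq => ?_⟩
    have hx' := eq_of_natCast_mem_window hn hx (by simpa using h _ hmem)
    refine ⟨-q, ?_, neg_neg q⟩
    rw [← window_eq_SetC hn, ← hx']
    exact h q hq
end

section
/- Let n be divisible by 6 and let p, q, r ∈ S be such that p ≄ q and d(p,q) < d(p,r). Then: (1) 0 < d(p,q) < (2/3)n; (2) d(p,q) + d(q,p) = (2/3)n; (3) d(q,q) = (2/3)n; (4) d(p,q) + d(q,r) = d(p,r). -/
/-- The position of a state of `S` in the increasing enumeration of `S`, counted from `0`. -/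
def posS (n : ℕ) (q : ℤ) : ℤ :=
  if 0 < q then q / 2 + n / 2 - 1 else (q - 1) / 2 + n / 2

lemma posS_bounds {m : ℕ} {q : ℤ} (hq : q ∈ SetS (6 * m)) :
    0 ≤ posS (6 * m) q ∧ posS (6 * m) q < 6 * m := by
  simp only [SetS, Set.mem_ofPred_eq, posS] at *
  push_cast at *
  split_ifs <;> omega

lemma posS_injOn (m : ℕ) : Set.InjOn (posS (6 * m)) (SetS (6 * m)) := by
  intro p hp q hq h
  simp only [SetS, Set.mem_ofPred_eq, posS] at *
  push_cast at *
  split_ifs at h <;> omega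

/-- In terms of positions, `ab` moves every state of `S` one step forward, except that the last
state returns to position `n / 3`. -/
lemma rotAB_posS {m : ℕ} {q : ℤ} (hq : q ∈ SetS (6 * m)) :
    rotAB (6 * m) q ∈ SetS (6 * m) ∧
      (posS (6 * m) (rotAB (6 * m) q) = posS (6 * m) q + 1 ∨
        (posS (6 * m) q = 6 * m - 1 ∧ posS (6 * m) (rotAB (6 * m) q) = 2 * m)) := by
  have key : rotAB (6 * m) q =
      if q = 6 * m then 1 - 2 * (m : ℤ) else if q = -1 then 2 else q + 2 := by
    simp only [SetS, Set.mem_ofPred_eq] at hq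
    push_cast at hq
    have h3 : (6 * (m : ℤ)) / 3 = 2 * m := by omega
    have ha : Bstep (6 * m) q false =
        if q = 6 * m then -(2 * (m : ℤ)) else if q = -1 then 1 else q + 1 := by
      simp only [Bstep, BposStep, Bool.false_eq_true, if_false]
      push_cast
      rw [h3]
      split_ifs <;> omega
    rw [rotAB, ha]
    simp only [Bstep, BposStep, if_true]
    push_cast
    rw [h3]
    split_ifs <;> omega
  rw [key]
  simp only [SetS, Set.mem_ofPred_eq, posS] at *
  push_cast at *
  split_ifs <;> omega

lemma iterate_rotAB_posS {m : ℕ} {q : ℤ} (hq : q ∈ SetS (6 * m)) (k : ℕ) :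
    (rotAB (6 * m))^[k] q ∈ SetS (6 * m) ∧
      4 * (m : ℤ) ∣ posS (6 * m) q + k - posS (6 * m) ((rotAB (6 * m))^[k] q) ∧
      min (2 * (m : ℤ)) k ≤ posS (6 * m) ((rotAB (6 * m))^[k] q) := by
  induction k with
  | zero =>
    have := (posS_bounds hq).1
    refine ⟨hq, by simp, ?_⟩
    simp only [Function.iterate_zero, id_eq]
    omega
  | succ k ih =>
    obtain ⟨hS, ⟨c, hc⟩, hle⟩ := ih
    rw [Function.iterate_succ_apply']
    obtain ⟨hS', h | ⟨h, h'⟩⟩ := rotAB_posS hS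
    · exact ⟨hS', ⟨c, by push_cast; linarith⟩, by push_cast; omega⟩
    · exact ⟨hS', ⟨c + 1, by push_cast; linarith⟩, by push_cast; omega⟩

lemma iterate_rotAB_eq_iff {m : ℕ} {p q : ℤ} (hp : p ∈ SetS (6 * m)) (hq : q ∈ SetS (6 * m))
    (k : ℕ) :
    (rotAB (6 * m))^[6 * m / 3 + k] p = (rotAB (6 * m))^[6 * m / 3] q ↔
      4 * (m : ℤ) ∣ posS (6 * m) p + k - posS (6 * m) q := by
  obtain ⟨hpS, hpd, hpl⟩ := iterate_rotAB_posS hp (6 * m / 3 + k)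
  obtain ⟨hqS, hqd, hql⟩ := iterate_rotAB_posS hq (6 * m / 3)
  have hpu := (posS_bounds hpS).2
  have hqu := (posS_bounds hqS).2
  rw [← (posS_injOn m).eq_iff hpS hqS]
  set x := posS (6 * m) ((rotAB (6 * m))^[6 * m / 3 + k] p)
  set y := posS (6 * m) ((rotAB (6 * m))^[6 * m / 3] q)
  have hxy := dvd_sub hpd hqd
  have hm : 6 * m / 3 = 2 * m := by omega
  rw [hm] at hxy hpl hql
  push_cast at hxy hpl hql
  constructor
  · intro h
    rw [h] at hxy
    ring_nf at hxy ⊢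
    exact hxy
  · intro h
    have hd := dvd_sub h hxy
    have : x - y = 0 := by
      refine Int.eq_zero_of_abs_lt_dvd (m := 4 * (m : ℤ)) ?_ (by rw [abs_lt]; omega)
      ring_nf at hd ⊢
      exact hd
    omega

lemma simeqB_iff {m : ℕ} {p q : ℤ} (hp : p ∈ SetS (6 * m)) (hq : q ∈ SetS (6 * m)) :
    simeqB (6 * m) p q ↔ 4 * (m : ℤ) ∣ posS (6 * m) p - posS (6 * m) q := by
  simpa [simeqB] using iterate_rotAB_eq_iff hp hq 0

/-- For `p, q ∈ S`, `d(p,q)` is the representative in `[1, 2n/3]` of the difference of the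
positions of `q` and `p` modulo `2n/3`. -/
lemma dB_spec {m : ℕ} {p q : ℤ} (hp : p ∈ SetS (6 * m)) (hq : q ∈ SetS (6 * m)) :
    1 ≤ dB (6 * m) p q ∧ dB (6 * m) p q ≤ 4 * m ∧
      4 * (m : ℤ) ∣ posS (6 * m) p + dB (6 * m) p q - posS (6 * m) q := by
  simp only [dB, hp, if_true, dpos, iterate_rotAB_eq_iff hp hq]
  have hm : 0 < 4 * (m : ℤ) := by
    have := posS_bounds hp
    omega
  set z := posS (6 * m) q - posS (6 * m) p - 1 with hz
  have h0 := Int.emod_nonneg z hm.ne'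
  have h1 := Int.emod_lt_of_pos z hm
  have hk : (z % (4 * m)).toNat + 1 ∈
      {k : ℕ | 1 ≤ k ∧ 4 * (m : ℤ) ∣ posS (6 * m) p + k - posS (6 * m) q} := by
    refine ⟨by omega, -(z / (4 * m)), ?_⟩
    have := Int.mul_ediv_add_emod z (4 * m)
    push_cast
    rw [Int.toNat_of_nonneg h0]
    linarith
  obtain ⟨h, h'⟩ := Nat.sInf_mem ⟨_, hk⟩
  exact ⟨h, (Nat.sInf_le hk).trans (by omega), h'⟩

/-- Properties of the distance on `ℬ_n` (`n` divisible by 6): for `p, q, r ∈ S`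
with `p ≄ q` and `d(p,q) < d(p,r)`, one has `0 < d(p,q) < 2n/3`,
`d(p,q) + d(q,p) = 2n/3`, `d(q,q) = 2n/3` and `d(p,q) + d(q,r) = d(p,r)`. -/
theorem dist_properties (n : ℕ) (hn : 6 ∣ n) (p q r : ℤ)
    (hp : p ∈ SetS n) (hq : q ∈ SetS n) (hr : r ∈ SetS n)
    (hpq : ¬ simeqB n p q) (hlt : dB n p q < dB n p r) :
    (0 < dB n p q ∧ dB n p q < 2 * n / 3) ∧
      dB n p q + dB n q p = 2 * n / 3 ∧
      dB n q q = 2 * n / 3 ∧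
      dB n p q + dB n q r = dB n p r := by
  obtain ⟨m, rfl⟩ := hn
  obtain ⟨hpq1, hpq2, hpq3⟩ := dB_spec hp hq
  obtain ⟨hqp1, hqp2, hqp3⟩ := dB_spec hq hp
  obtain ⟨hqq1, hqq2, hqq3⟩ := dB_spec hq hq
  obtain ⟨hpr1, hpr2, hpr3⟩ := dB_spec hp hr
  obtain ⟨hqr1, hqr2, hqr3⟩ := dB_spec hq hr
  rw [simeqB_iff hp hq] at hpq
  have hne : dB (6 * m) p q ≠ 4 * m := by
    intro h
    rw [h] at hpq3
    apply hpq
    have := dvd_sub hpq3 (dvd_refl (4 * (m : ℤ)))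
    push_cast at this
    ring_nf at this ⊢
    exact this
  have h2 : (dB (6 * m) p q : ℤ) + dB (6 * m) q p - 4 * m = 0 := by
    refine Int.eq_zero_of_abs_lt_dvd (m := 4 * (m : ℤ)) ?_ (by rw [abs_lt]; omega)
    have := dvd_sub (dvd_add hpq3 hqp3) (dvd_refl (4 * (m : ℤ)))
    ring_nf at this ⊢
    exact this
  have h3 : (dB (6 * m) q q : ℤ) - 4 * m = 0 := by
    refine Int.eq_zero_of_abs_lt_dvd (m := 4 * (m : ℤ)) ?_ (by rw [abs_lt]; omega)
    have := dvd_sub hqq3 (dvd_refl (4 * (m : ℤ)))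
    ring_nf at this ⊢
    exact this
  have h4 : (dB (6 * m) p q : ℤ) + dB (6 * m) q r - dB (6 * m) p r = 0 := by
    refine Int.eq_zero_of_abs_lt_dvd (m := 4 * (m : ℤ)) ?_ (by rw [abs_lt]; omega)
    have := dvd_sub (dvd_add hpq3 hqr3) hpr3
    ring_nf at this ⊢
    exact this
  omega
end

section
/- Let n be divisible by 6, let p, q ∈ C and let w ∈ {a,b}* be a word, acting in ℬ_n. If d(pw, qw) = (2/3)n, then pw = qw. -/
theorem ne_zero_of_mem_SetS {n : ℕ} {x : ℤ} (hx : x ∈ SetS n) : x ≠ 0 := by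
  simp only [SetS, Set.mem_ofPred_eq] at hx
  omega

theorem neg_notMem_SetS {n : ℕ} {x : ℤ} (hx : x ∈ SetS n) : -x ∉ SetS n := by
  simp only [SetS, Set.mem_ofPred_eq] at hx ⊢
  omega

/-- Every letter maps `S` into `-S`. -/
theorem neg_Bstep_mem_SetS {n : ℕ} (hn : 6 ∣ n) {x : ℤ} (hx : x ∈ SetS n) (s : Bool) :
    -Bstep n x s ∈ SetS n := by
  simp only [SetS, Set.mem_ofPred_eq] at hx ⊢
  unfold Bstep BposStep
  cases s <;> simp only [Bool.false_eq_true, if_true, if_false] <;> split_ifs <;> omega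

theorem Bstep_mem_SetS {n : ℕ} (hn : 6 ∣ n) {x : ℤ} (hx : -x ∈ SetS n) (s : Bool) :
    Bstep n x s ∈ SetS n := by
  have h := neg_Bstep_mem_SetS hn hx s
  rwa [Bstep_neg n (by have := ne_zero_of_mem_SetS hx; omega), neg_neg] at h

/-- On absolute values the letters act as partial involutions exchanging neighbours, except that
`n` is sent to `n/3` and `1` may be fixed. -/
theorem natAbs_Bstep {n : ℕ} (hn : 6 ∣ n) {x : ℤ} (hx : x ∈ SetS n) (s : Bool) :
    (x.natAbs = n ∧ (Bstep n x s).natAbs = n / 3) ∨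
      (x.natAbs = 1 ∧ (Bstep n x s).natAbs = 1) ∨
      (x.natAbs % 2 = (if s then 0 else 1) ∧ (Bstep n x s).natAbs + 1 = x.natAbs) ∨
      (x.natAbs % 2 = (if s then 1 else 0) ∧ (Bstep n x s).natAbs = x.natAbs + 1) := by
  simp only [SetS, Set.mem_ofPred_eq] at hx
  unfold Bstep BposStep
  cases s <;> simp only [Bool.false_eq_true, if_true, if_false] <;> split_ifs <;> omega

/-- For `x, y` in `S`, if `|x| + |y|` is not `4n/3 + 1`, then it is not `4n/3 + 1` after reading
one letter either. -/
theorem natAbs_Bstep_add_natAbs_Bstep_ne {n : ℕ} (hn : 6 ∣ n) {x y : ℤ} (hx : x ∈ SetS n)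
    (hy : y ∈ SetS n) (h : x.natAbs + y.natAbs ≠ 4 * (n / 3) + 1) (s : Bool) :
    (Bstep n x s).natAbs + (Bstep n y s).natAbs ≠ 4 * (n / 3) + 1 := by
  have bound : ∀ z ∈ SetS n, -(n : ℤ) ≤ z ∧ z ≤ n := by
    intro z hz
    simp only [SetS, Set.mem_ofPred_eq] at hz
    omega
  have hx₁ := bound x hx
  have hy₁ := bound y hy
  have hx₂ := bound _ (neg_Bstep_mem_SetS hn hx s)
  have hy₂ := bound _ (neg_Bstep_mem_SetS hn hy s)
  have hx₃ : 0 < n := by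
    have := ne_zero_of_mem_SetS hx
    omega
  have h₁ := natAbs_Bstep hn hx s
  have h₂ := natAbs_Bstep hn hy s
  cases s <;> simp only [Bool.false_eq_true, if_true, if_false] at h₁ h₂ <;>
    rcases h₁ with h₁ | h₁ | h₁ | h₁ <;> rcases h₂ with h₂ | h₂ | h₂ | h₂ <;> omega

theorem Bact_pair_invariant {n : ℕ} (hn : 6 ∣ n) (w : List Bool) {x y : ℤ}
    (hxy : (x ∈ SetS n ∧ y ∈ SetS n) ∨ (-x ∈ SetS n ∧ -y ∈ SetS n))
    (h : x.natAbs + y.natAbs ≠ 4 * (n / 3) + 1) :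
    ((Bact n x w ∈ SetS n ∧ Bact n y w ∈ SetS n) ∨
      (-Bact n x w ∈ SetS n ∧ -Bact n y w ∈ SetS n)) ∧
      (Bact n x w).natAbs + (Bact n y w).natAbs ≠ 4 * (n / 3) + 1 := by
  induction w generalizing x y with
  | nil => exact ⟨hxy, h⟩
  | cons s w ih =>
    refine ih (x := Bstep n x s) (y := Bstep n y s) ?_ ?_
    · rcases hxy with ⟨hx, hy⟩ | ⟨hx, hy⟩
      · exact Or.inr ⟨neg_Bstep_mem_SetS hn hx s, neg_Bstep_mem_SetS hn hy s⟩
      · exact Or.inl ⟨Bstep_mem_SetS hn hx s, Bstep_mem_SetS hn hy s⟩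
    · rcases hxy with ⟨hx, hy⟩ | ⟨hx, hy⟩
      · exact natAbs_Bstep_add_natAbs_Bstep_ne hn hx hy h s
      · have := natAbs_Bstep_add_natAbs_Bstep_ne hn hx hy
          (by rwa [Int.natAbs_neg, Int.natAbs_neg]) s
        rwa [Bstep_neg n (by have := ne_zero_of_mem_SetS hx; omega),
          Bstep_neg n (by have := ne_zero_of_mem_SetS hy; omega), Int.natAbs_neg,
          Int.natAbs_neg] at this

theorem rotAB_mem_SetS {n : ℕ} (hn : 6 ∣ n) {x : ℤ} (hx : x ∈ SetS n) : rotAB n x ∈ SetS n :=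
  Bstep_mem_SetS hn (neg_Bstep_mem_SetS hn hx false) true

/-- The rank `⌊(x + 1) / 2⌋` of `x` in `S` grows by one, modulo `2n/3`, when `ab` is read. -/
theorem rank_rotAB_modEq {n : ℕ} (hn : 6 ∣ n) {x : ℤ} (hx : x ∈ SetS n) :
    (rotAB n x + 1) / 2 ≡ (x + 1) / 2 + 1 [ZMOD 2 * ((n : ℤ) / 3)] := by
  have : (rotAB n x + 1) / 2 = (x + 1) / 2 + 1 ∨
      (rotAB n x + 1) / 2 + 2 * ((n : ℤ) / 3) = (x + 1) / 2 + 1 := by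
    simp only [SetS, Set.mem_ofPred_eq] at hx
    unfold rotAB
    have ha : (x = n ∧ Bstep n x false = -((n : ℤ) / 3)) ∨ (x = -1 ∧ Bstep n x false = 1) ∨
        (x ≠ n ∧ x ≠ -1 ∧ Bstep n x false = x + 1) := by
      unfold Bstep BposStep
      simp only [Bool.false_eq_true, if_false]
      split_ifs <;> omega
    generalize Bstep n x false = y at ha ⊢
    unfold Bstep BposStep
    simp only [if_true]
    split_ifs <;> omega
  rcases this with h | h
  · rw [h]
  · rw [← h]
    exact Int.ModEq.symm (by simp [Int.ModEq])

theorem rank_iterate_rotAB_modEq {n : ℕ} (hn : 6 ∣ n) {x : ℤ} (hx : x ∈ SetS n) (k : ℕ) :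
    (rotAB n)^[k] x ∈ SetS n ∧
      ((rotAB n)^[k] x + 1) / 2 ≡ (x + 1) / 2 + k [ZMOD 2 * ((n : ℤ) / 3)] := by
  induction k with
  | zero => simpa using hx
  | succ k ih =>
    rw [Function.iterate_succ_apply']
    refine ⟨rotAB_mem_SetS hn ih.1, (rank_rotAB_modEq hn ih.1).trans ?_⟩
    rw [Nat.cast_succ, ← add_assoc]
    exact ih.2.add_right 1

theorem eq_or_natAbs_add_natAbs_eq_of_dpos_eq {n : ℕ} (hn : 6 ∣ n) {x y : ℤ} (hx : x ∈ SetS n)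
    (hy : y ∈ SetS n) (h : dpos n x y = 2 * n / 3) :
    x = y ∨ x.natAbs + y.natAbs = 4 * (n / 3) + 1 := by
  have hpos : 0 < dpos n x y := by
    simp only [SetS, Set.mem_ofPred_eq] at hx
    omega
  have hmem := (Nat.sInf_mem (Nat.nonempty_of_pos_sInf hpos)).2
  change (rotAB n)^[n / 3 + dpos n x y] x = (rotAB n)^[n / 3] y at hmem
  have h1 := (rank_iterate_rotAB_modEq hn hx (n / 3 + dpos n x y)).2
  have h2 := (rank_iterate_rotAB_modEq hn hy (n / 3)).2
  rw [hmem] at h1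
  obtain ⟨c, hc⟩ := (h1.symm.trans h2).dvd
  have hd : (dpos n x y : ℤ) = 2 * ((n : ℤ) / 3) := by omega
  push_cast at hc
  rw [hd] at hc
  have hc' : (y + 1) / 2 - (x + 1) / 2 = 2 * ((n : ℤ) / 3) * (c + 1) := by linarith
  simp only [SetS, Set.mem_ofPred_eq] at hx hy
  have hlo : -2 < c + 1 := by
    by_contra hcon
    have : 2 * ((n : ℤ) / 3) * (c + 1) ≤ 2 * ((n : ℤ) / 3) * (-2) :=
      mul_le_mul_of_nonneg_left (by omega) (by omega)
    omega
  have hhi : c + 1 < 2 := by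
    by_contra hcon
    have : 2 * ((n : ℤ) / 3) * 2 ≤ 2 * ((n : ℤ) / 3) * (c + 1) :=
      mul_le_mul_of_nonneg_left (by omega) (by omega)
    omega
  generalize c + 1 = e at hc' hlo hhi
  interval_cases e <;> omega

/-- For `n` divisible by 6, `p, q ∈ C` and a word `w` acting in `ℬ_n`:
if `d(pw, qw) = 2n/3` then `pw = qw`. -/
theorem C_pair_sync (n : ℕ) (hn : 6 ∣ n) (p q : ℤ)
    (hp : p ∈ SetC n) (hq : q ∈ SetC n) (w : List Bool)
    (h : dB n (Bact n p w) (Bact n q w) = 2 * n / 3) :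
    Bact n p w = Bact n q w := by
  have hinit : p.natAbs + q.natAbs ≠ 4 * (n / 3) + 1 := by
    simp only [SetC, SetS, Set.mem_ofPred_eq] at hp hq
    omega
  obtain ⟨hS, hne⟩ := Bact_pair_invariant hn w (Or.inl ⟨hp.1, hq.1⟩) hinit
  rcases hS with ⟨hx, hy⟩ | ⟨hx, hy⟩
  · rw [dB, if_pos hx] at h
    exact (eq_or_natAbs_add_natAbs_eq_of_dpos_eq hn hx hy h).resolve_right hne
  · rw [dB, if_neg (by simpa using neg_notMem_SetS hx)] at h
    rcases eq_or_natAbs_add_natAbs_eq_of_dpos_eq hn hy hx h with h | h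
    · exact (neg_injective h).symm
    · rw [Int.natAbs_neg, Int.natAbs_neg, add_comm] at h
      exact absurd h hne
end

section
/- Let n be divisible by 6, let w ∈ {a,b}* be a word acting in ℬ_n, and let p, q ∈ C. (1) For any k with 2 ≤ k ≤ (2/3)n − 2: if d(p,q) ≤ k−1 and d(pw,qw) = k+1, then the switch count satisfies |w|_s ≥ (2/3)n + 2k − 1 when 2 ≤ k ≤ n/3, and |w|_s ≥ 2n − 2k + 1 when n/3 + 1 ≤ k ≤ (2/3)n − 2. (2) For k = (2/3)n − 1: if d(p,q) = k−1 and d(pw,qw) = k+1, then |w|_s ≥ 2n − 2k + 1. -/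
/-- The state of `ℬ_n` at position `L` on the line `1 - n, …, n`, along which `-n, …, -1, 1, …, n`
are placed in increasing order. -/
def lineState (L : ℤ) : ℤ := if 0 < L then L else L - 1

/-- The transitions of `ℬ_{6g}` in terms of line positions. -/
def lineStep (g L : ℤ) (s : Bool) : ℤ :=
  if L = 6 * g then 1 - 2 * g
  else if L = 1 - 6 * g then 2 * g
  else if (L % 2 = 0 ↔ s = false) then L + 1 else L - 1

/-- Positions of pairs that are reachable from pairs of states of the cycle `C`. -/
structure AdmissiblePair (g P Q : ℤ) : Prop where
  left_ge : 1 - 6 * g ≤ P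
  left_le : P ≤ 6 * g
  right_ge : 1 - 6 * g ≤ Q
  right_le : Q ≤ 6 * g
  parity : P % 2 = Q % 2
  sub_le : Q - P ≤ 8 * g - 2
  le_sub : -(8 * g - 2) ≤ Q - P

theorem Bstep_lineState {g : ℕ} (hg : 0 < g) {L : ℤ} (h₁ : 1 - 6 * (g : ℤ) ≤ L)
    (h₂ : L ≤ 6 * g) (s : Bool) :
    Bstep (6 * g) (lineState L) s = lineState (lineStep g L s) := by
  have hn : ((6 * g : ℕ) : ℤ) = 6 * g := by push_cast; ring
  have hd : (6 * (g : ℤ)) / 3 = 2 * g := by omega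
  cases s <;> simp only [Bstep, BposStep, lineState, lineStep, hn, hd, if_true, if_false,
    Bool.false_eq_true, reduceCtorEq, iff_true, iff_false] <;> split_ifs <;> omega

theorem lineStep_mem {g L : ℤ} (hg : 0 < g) (h₁ : 1 - 6 * g ≤ L) (h₂ : L ≤ 6 * g) (s : Bool) :
    1 - 6 * g ≤ lineStep g L s ∧ lineStep g L s ≤ 6 * g := by
  cases s <;> simp only [lineStep, reduceCtorEq, iff_true, iff_false] <;> split_ifs <;> omega

theorem AdmissiblePair.step {g P Q : ℤ} (hg : 0 < g) (h : AdmissiblePair g P Q) (s : Bool) :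
    AdmissiblePair g (lineStep g P s) (lineStep g Q s) := by
  obtain ⟨h₁, h₂, h₃, h₄, h₅, h₆, h₇⟩ := h
  have hP := lineStep_mem hg h₁ h₂ s
  have hQ := lineStep_mem hg h₃ h₄ s
  refine ⟨hP.1, hP.2, hQ.1, hQ.2, ?_, ?_, ?_⟩ <;> clear hP hQ <;> cases s <;>
    simp only [lineStep, reduceCtorEq, iff_true, iff_false] <;> split_ifs <;> omega

theorem AdmissiblePair.swap {g P Q : ℤ} (h : AdmissiblePair g P Q) : AdmissiblePair g Q P := by
  obtain ⟨h₁, h₂, h₃, h₄, h₅, h₆, h₇⟩ := h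
  constructor <;> omega

/-! ### Distances in terms of line positions -/

theorem rotAB_lineState {g : ℕ} (hg : 0 < g) {X : ℤ} (h₁ : 1 - 3 * (g : ℤ) ≤ X)
    (h₂ : X ≤ 3 * g) :
    rotAB (6 * g) (lineState (2 * X)) =
      lineState (2 * if X = 3 * (g : ℤ) then 1 - (g : ℤ) else X + 1) := by
  have hg' : (0 : ℤ) < g := by exact_mod_cast hg
  have hm := lineStep_mem hg' (L := 2 * X) (by omega) (by omega) false
  rw [rotAB, Bstep_lineState hg (by omega) (by omega), Bstep_lineState hg hm.1 hm.2]
  congr 1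
  clear hm
  simp only [lineStep, reduceCtorEq, iff_true, iff_false]
  split_ifs <;> omega

theorem exists_rotAB_iterate {g : ℕ} (hg : 0 < g) {X : ℤ} (h₁ : 1 - 3 * (g : ℤ) ≤ X)
    (h₂ : X ≤ 3 * g) (j : ℕ) :
    ∃ Y : ℤ, (rotAB (6 * g))^[j] (lineState (2 * X)) = lineState (2 * Y) ∧
      1 - 3 * (g : ℤ) ≤ Y ∧ Y ≤ 3 * g ∧ 4 * (g : ℤ) ∣ Y - (X + j) ∧
      (1 - (g : ℤ) ≤ X + j → 1 - (g : ℤ) ≤ Y) := by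
  induction j with
  | zero => exact ⟨X, rfl, h₁, h₂, by simp, by simp⟩
  | succ j ih =>
    obtain ⟨Y, hY, hY₁, hY₂, ⟨c, hc⟩, hY₃⟩ := ih
    rw [Function.iterate_succ_apply', hY, rotAB_lineState hg hY₁ hY₂]
    refine ⟨_, rfl, ?_⟩
    split_ifs with h
    · refine ⟨by omega, by omega, ⟨c - 1, ?_⟩, by omega⟩
      push_cast
      linear_combination hc - h
    · refine ⟨by omega, by omega, ⟨c, ?_⟩, ?_⟩
      · push_cast
        linear_combination hc
      · intro hX
        push_cast at hX
        rcases lt_or_ge (X + j) (1 - g) with h' | h'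
        · have hc0 : 4 * (g : ℤ) * c ≥ 0 := by
            by_contra hneg
            have : c ≤ -1 := by
              by_contra h0
              exact hneg (mul_nonneg (by positivity) (by omega))
            nlinarith
          omega
        · have := hY₃ h'
          omega

theorem lineState_injective : Function.Injective lineState := by
  intro a b h
  simp only [lineState] at h
  split_ifs at h <;> omega

theorem rotAB_iterate_eq_iff {g : ℕ} (hg : 0 < g) {X Z : ℤ} (hX₁ : 1 - 3 * (g : ℤ) ≤ X)
    (hX₂ : X ≤ 3 * g) (hZ₁ : 1 - 3 * (g : ℤ) ≤ Z) (hZ₂ : Z ≤ 3 * g) (k : ℕ) :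
    (rotAB (6 * g))^[6 * g / 3 + k] (lineState (2 * X)) =
      (rotAB (6 * g))^[6 * g / 3] (lineState (2 * Z)) ↔ 4 * (g : ℤ) ∣ k - (Z - X) := by
  have hd : 6 * g / 3 = 2 * g := by omega
  rw [hd]
  obtain ⟨Y, hY, -, hY₂, ⟨c, hc⟩, hY₃⟩ := exists_rotAB_iterate hg hX₁ hX₂ (2 * g + k)
  obtain ⟨W, hW, -, hW₂, ⟨e, he⟩, hW₃⟩ := exists_rotAB_iterate hg hZ₁ hZ₂ (2 * g)
  rw [hY, hW, lineState_injective.eq_iff]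
  push_cast at *
  have hY₄ := hY₃ (by omega)
  have hW₄ := hW₃ (by omega)
  constructor
  · intro h
    exact ⟨e - c, by linarith⟩
  · rintro ⟨f, hf⟩
    have : Y - W = 0 := by
      refine Int.eq_zero_of_abs_lt_dvd (m := 4 * g) ⟨f + c - e, ?_⟩ (abs_lt.2 ⟨?_, ?_⟩)
      · linear_combination hc - he + hf
      · omega
      · omega
    omega

theorem dpos_lineState {g : ℕ} (hg : 0 < g) {X Z : ℤ} (hX₁ : 1 - 3 * (g : ℤ) ≤ X)
    (hX₂ : X ≤ 3 * g) (hZ₁ : 1 - 3 * (g : ℤ) ≤ Z) (hZ₂ : Z ≤ 3 * g)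
    (h₁ : Z - X ≤ 4 * g - 1) (h₂ : -(4 * (g : ℤ) - 1) ≤ Z - X) :
    (dpos (6 * g) (lineState (2 * X)) (lineState (2 * Z)) : ℤ) =
      if 0 < Z - X then Z - X else Z - X + 4 * g := by
  set v : ℤ := if 0 < Z - X then Z - X else Z - X + 4 * g with hv
  have hv₁ : 1 ≤ v := by rw [hv]; split_ifs <;> omega
  have hv₂ : v ≤ 4 * g := by rw [hv]; split_ifs <;> omega
  have hv₃ : 4 * (g : ℤ) ∣ v - (Z - X) := by
    rw [hv]; split_ifs
    · simp
    · exact ⟨1, by ring⟩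
  suffices h : dpos (6 * g) (lineState (2 * X)) (lineState (2 * Z)) = v.toNat by
    rw [h]; omega
  refine IsLeast.csInf_eq ⟨⟨by omega, ?_⟩, ?_⟩
  · rw [rotAB_iterate_eq_iff hg hX₁ hX₂ hZ₁ hZ₂, Int.toNat_of_nonneg (by omega)]
    exact hv₃
  · rintro k ⟨hk, hk'⟩
    rw [rotAB_iterate_eq_iff hg hX₁ hX₂ hZ₁ hZ₂] at hk'
    by_contra hlt
    have hdvd : 4 * (g : ℤ) ∣ v - k := by
      have := dvd_sub hv₃ hk'
      rwa [sub_sub_sub_cancel_right] at this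
    have := Int.eq_zero_of_abs_lt_dvd hdvd (abs_lt.2 ⟨by omega, by omega⟩)
    omega

theorem lineState_mem_SetS_iff {g : ℕ} {L : ℤ} (h₁ : 1 - 6 * (g : ℤ) ≤ L) (h₂ : L ≤ 6 * g) :
    lineState L ∈ SetS (6 * g) ↔ L % 2 = 0 := by
  simp only [SetS, lineState, Set.mem_ofPred_eq]
  push_cast
  split_ifs <;> omega

theorem neg_lineState (L : ℤ) : -lineState L = lineState (1 - L) := by
  simp only [lineState]
  split_ifs <;> omega

theorem AdmissiblePair.two_mul_dB {g : ℕ} (hg : 0 < g) {P Q : ℤ} (h : AdmissiblePair g P Q) :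
    2 * (dB (6 * g) (lineState P) (lineState Q) : ℤ) =
      if 0 < Q - P then Q - P else Q - P + 8 * g := by
  obtain ⟨h₁, h₂, h₃, h₄, h₅, h₆, h₇⟩ := h
  rw [dB, lineState_mem_SetS_iff h₁ h₂]
  split_ifs with hP hPQ hPQ
  all_goals
    try rw [neg_lineState, neg_lineState]
    first
    | obtain ⟨X, rfl⟩ : ∃ X, P = 2 * X := ⟨P / 2, by omega⟩
      obtain ⟨Z, rfl⟩ : ∃ Z, Q = 2 * Z := ⟨Q / 2, by omega⟩
      rw [dpos_lineState hg (by omega) (by omega) (by omega) (by omega) (by omega) (by omega)]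
    | obtain ⟨X, rfl⟩ : ∃ X, P = 1 - 2 * X := ⟨(1 - P) / 2, by omega⟩
      obtain ⟨Z, rfl⟩ : ∃ Z, Q = 1 - 2 * Z := ⟨(1 - Q) / 2, by omega⟩
      rw [sub_sub_cancel, sub_sub_cancel,
        dpos_lineState hg (by omega) (by omega) (by omega) (by omega) (by omega) (by omega)]
    split_ifs <;> omega

/-! ### Lower bounds for the number of switches -/

/-- The claimed lower bound for the number of switches needed to get from distance at
most `k - 1` to distance `k + 1`. -/
def switchBound (g k : ℤ) : ℤ := min (4 * g + 2 * k - 1) (12 * g - 2 * k + 1)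

/-- `1` if reading the symbol `s` moves an inner position `P` to the right, `0` otherwise. -/
def movesRight (P : ℤ) (s : Bool) : ℤ := if (P % 2 = 0 ↔ s = false) then 1 else 0

/-- The switch bound, corrected for the case that the last symbol read was `b`, so that reading
another `b` costs no further switch. -/
def switchCap (g k : ℤ) (l : Bool) : ℤ := switchBound g k - if l then 1 else 0

/-- A lower bound for the number of further switches needed, after reading the symbol `l`, to
bring the pair at positions `P, Q` to distance `k + 1`. -/
def switchPotential (g k P Q : ℤ) (l : Bool) : ℤ :=
  if Q - P = 0 then switchCap g k l
  else if Q - P = 2 * k then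
    min (switchCap g k l) (min (6 * g - Q - movesRight P l) (P + 6 * g - 2 + movesRight P l))
  else if Q - P = 2 * k - 8 * g then
    min (switchCap g k l) (min (4 * g - 1) (8 * g - 2 * k - 1) + 1 +
      min (6 * g - P - movesRight P l) (Q + 6 * g - 2 + movesRight P l))
  else if (0 < Q - P ∧ Q - P < 2 * k) ∨ Q - P < 2 * k - 8 * g then switchCap g k l
  else 0

theorem switchPotential_self (g k P : ℤ) (l : Bool) :
    switchPotential g k P P l = switchCap g k l := by
  simp [switchPotential]

theorem switchCap_le (g k : ℤ) (l s : Bool) :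
    switchCap g k l ≤ (if l = s then 0 else 1) + switchCap g k s := by
  cases l <;> cases s <;> simp [switchCap]
  omega

theorem lineStep_of_ne {g P : ℤ} (h₁ : P ≠ 6 * g) (h₂ : P ≠ 1 - 6 * g) (s : Bool) :
    lineStep g P s = P + 2 * movesRight P s - 1 := by
  simp only [lineStep, if_neg h₁, if_neg h₂, movesRight]
  split_ifs <;> ring

theorem lineStep_right (g : ℤ) (s : Bool) : lineStep g (6 * g) s = 1 - 2 * g := by
  simp [lineStep]

theorem movesRight_of_even {P : ℤ} (h : P % 2 = 0) (s : Bool) :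
    movesRight P s = if s then 0 else 1 := by
  cases s <;> simp [movesRight, h]

theorem movesRight_of_odd {P : ℤ} (h : P % 2 = 1) (s : Bool) :
    movesRight P s = if s then 1 else 0 := by
  cases s <;> simp [movesRight, h]

theorem lineStep_one_sub {g : ℤ} (hg : 0 < g) (L : ℤ) (s : Bool) :
    lineStep g (1 - L) s = 1 - lineStep g L s := by
  cases s <;> simp only [lineStep, reduceCtorEq, iff_true, iff_false] <;> split_ifs <;> omega

theorem switchPotential_one_sub {P Q : ℤ} (h : P % 2 = Q % 2) (g k : ℤ) (l : Bool) :
    switchPotential g k (1 - Q) (1 - P) l = switchPotential g k P Q l := by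
  have hM : movesRight (1 - Q) l = 1 - movesRight P l := by
    rcases Int.emod_two_eq_zero_or_one P with hp | hp
    · rw [movesRight_of_even hp, movesRight_of_odd (by omega)]
      cases l <;> rfl
    · rw [movesRight_of_odd hp, movesRight_of_even (by omega)]
      cases l <;> rfl
  simp only [switchPotential, hM, sub_sub_sub_cancel_left]
  split_ifs <;> omega

theorem AdmissiblePair.one_sub {g P Q : ℤ} (h : AdmissiblePair g P Q) :
    AdmissiblePair g (1 - Q) (1 - P) := by
  obtain ⟨h₁, h₂, h₃, h₄, h₅, h₆, h₇⟩ := h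
  constructor <;> omega

set_option maxHeartbeats 1000000 in
theorem switchPotential_le_step_of_generic {g P Q : ℤ} (k : ℤ)
    (h : P % 2 = Q % 2) (hP : P ≠ 6 * g) (hP' : P ≠ 1 - 6 * g)
    (hQ : Q ≠ 6 * g) (hQ' : Q ≠ 1 - 6 * g) (l s : Bool) :
    switchPotential g k P Q l ≤
      (if l = s then 0 else 1) + switchPotential g k (lineStep g P s) (lineStep g Q s) s := by
  have hM : movesRight Q s = movesRight P s := by simp only [movesRight, h]
  rw [lineStep_of_ne hP hP', lineStep_of_ne hQ hQ', hM]
  have hD : Q + 2 * movesRight P s - 1 - (P + 2 * movesRight P s - 1) = Q - P := by ring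
  simp only [switchPotential, hD]
  have hcap := switchCap_le g k l s
  rcases Int.emod_two_eq_zero_or_one P with hp | hp
  · have hp' : (P + 2 * movesRight P s - 1) % 2 = 1 := by omega
    rw [movesRight_of_odd hp', movesRight_of_even hp, movesRight_of_even hp]
    cases l <;> cases s <;> simp at hcap ⊢ <;> split_ifs <;> omega
  · have hp' : (P + 2 * movesRight P s - 1) % 2 = 0 := by omega
    rw [movesRight_of_even hp', movesRight_of_odd hp, movesRight_of_odd hp]
    cases l <;> cases s <;> simp at hcap ⊢ <;> split_ifs <;> omega

set_option maxHeartbeats 1000000 in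
theorem switchPotential_le_step_of_left_eq {g k Q : ℤ} (hg : 0 < g) (hk : 2 ≤ k)
    (hk' : k ≤ 4 * g - 1) (h : AdmissiblePair g (6 * g) Q) (hQ : Q ≠ 6 * g) (l s : Bool)
    (hne : k = 4 * g - 1 → lineStep g (6 * g) s ≠ lineStep g Q s) :
    switchPotential g k (6 * g) Q l ≤
      (if l = s then 0 else 1) + switchPotential g k (lineStep g (6 * g) s) (lineStep g Q s) s := by
  obtain ⟨-, -, h₃, h₄, h₅, h₆, h₇⟩ := h
  have hev : (6 * g) % 2 = 0 := by omega
  have hod : (1 - 2 * g) % 2 = 1 := by omega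
  rw [lineStep_right, lineStep_of_ne hQ (by omega), movesRight_of_even (by omega)] at *
  simp only [switchPotential, switchCap, switchBound, movesRight_of_even hev,
    movesRight_of_odd hod]
  cases l <;> cases s <;> simp at hne ⊢ <;> split_ifs <;> omega

set_option maxHeartbeats 1000000 in
theorem switchPotential_le_step_of_right_eq {g k P : ℤ} (hk : 2 ≤ k)
    (hk' : k ≤ 4 * g - 1) (h : AdmissiblePair g P (6 * g)) (hP : P ≠ 6 * g) (l s : Bool)
    (hne : k = 4 * g - 1 → lineStep g P s ≠ lineStep g (6 * g) s) :
    switchPotential g k P (6 * g) l ≤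
      (if l = s then 0 else 1) + switchPotential g k (lineStep g P s) (lineStep g (6 * g) s) s := by
  obtain ⟨h₁, h₂, -, -, h₅, h₆, h₇⟩ := h
  have hp : P % 2 = 0 := by omega
  rw [lineStep_right, lineStep_of_ne hP (by omega), movesRight_of_even hp] at *
  simp only [switchPotential, switchCap, switchBound, movesRight_of_even hp]
  rw [movesRight_of_odd (by cases s <;> simp <;> omega)]
  cases l <;> cases s <;> simp at hne ⊢ <;> split_ifs <;> omega

theorem switchPotential_le_step {g k P Q : ℤ} (hg : 0 < g) (hk : 2 ≤ k) (hk' : k ≤ 4 * g - 1)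
    (h : AdmissiblePair g P Q) (l s : Bool)
    (hne : k = 4 * g - 1 → lineStep g P s ≠ lineStep g Q s) :
    switchPotential g k P Q l ≤
      (if l = s then 0 else 1) + switchPotential g k (lineStep g P s) (lineStep g Q s) s := by
  have key : ∀ {P Q : ℤ}, AdmissiblePair g P Q →
      (k = 4 * g - 1 → lineStep g P s ≠ lineStep g Q s) → P ≠ Q → P = 6 * g ∨ Q = 6 * g →
      switchPotential g k P Q l ≤
        (if l = s then 0 else 1) + switchPotential g k (lineStep g P s) (lineStep g Q s) s := by
    rintro P Q h hne hPQ (rfl | rfl)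
    · exact switchPotential_le_step_of_left_eq hg hk hk' h hPQ.symm l s hne
    · exact switchPotential_le_step_of_right_eq hk hk' h hPQ l s hne
  rcases eq_or_ne P Q with rfl | hPQ
  · simpa only [switchPotential_self] using switchCap_le g k l s
  by_cases hr : P = 6 * g ∨ Q = 6 * g
  · exact key h hne hPQ hr
  by_cases hl : 1 - Q = 6 * g ∨ 1 - P = 6 * g
  · have := key h.one_sub (fun hk => by
      rw [lineStep_one_sub hg, lineStep_one_sub hg]
      have := hne hk
      omega) (by omega) hl
    rwa [lineStep_one_sub hg, lineStep_one_sub hg, switchPotential_one_sub h.parity,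
      switchPotential_one_sub (h.step hg s).parity] at this
  exact switchPotential_le_step_of_generic k h.parity (by omega) (by omega) (by omega) (by omega)
    l s

theorem switchPotential_nonpos {g k P Q : ℤ} (hk : 0 < k) (hD : Q - P = 2 * k)
    (h : Q = 6 * g ∨ P = 1 - 6 * g) (l : Bool) : switchPotential g k P Q l ≤ 0 := by
  rw [switchPotential, if_neg (by omega), if_pos hD, movesRight]
  split_ifs <;> omega

/-- Two distinct positions are mapped to the same one only if they are at maximal distance and one
of them is an end of the line. -/
theorem AdmissiblePair.of_lineStep_eq {g P Q : ℤ} (h : AdmissiblePair g P Q)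
    (hPQ : P ≠ Q) {s : Bool} (hs : lineStep g P s = lineStep g Q s) :
    (Q - P = 2 * (4 * g - 1) ∧ (Q = 6 * g ∨ P = 1 - 6 * g)) ∨
      (P - Q = 2 * (4 * g - 1) ∧ (P = 6 * g ∨ Q = 1 - 6 * g)) := by
  obtain ⟨h₁, h₂, h₃, h₄, h₅, h₆, h₇⟩ := h
  cases s <;> simp only [lineStep, reduceCtorEq, iff_true, iff_false] at hs <;>
    split_ifs at hs <;> omega

/-- A lower bound for the number of further switches needed, after reading the symbol `l`, to
bring both states of the pair at positions `P, Q` to the same position. -/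
def collapsePotential (g P Q : ℤ) (l : Bool) : ℤ :=
  if P = Q then 0
  else min (switchPotential g (4 * g - 1) P Q l) (switchPotential g (4 * g - 1) Q P l)

theorem collapsePotential_le_step {g P Q : ℤ} (hg : 0 < g) (h : AdmissiblePair g P Q)
    (l s : Bool) :
    collapsePotential g P Q l ≤
      (if l = s then 0 else 1) + collapsePotential g (lineStep g P s) (lineStep g Q s) s := by
  have hc : (0 : ℤ) ≤ if l = s then 0 else 1 := by split_ifs <;> omega
  rcases eq_or_ne P Q with rfl | hPQ
  · simpa only [collapsePotential, if_true, add_zero] using hc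
  rw [collapsePotential, if_neg hPQ]
  rcases eq_or_ne (lineStep g P s) (lineStep g Q s) with hs | hs
  · have hmin : min (switchPotential g (4 * g - 1) P Q l)
        (switchPotential g (4 * g - 1) Q P l) ≤ 0 :=
      (h.of_lineStep_eq hPQ hs).elim
        (fun H => min_le_of_left_le (switchPotential_nonpos (by omega) H.1 H.2 l))
        (fun H => min_le_of_right_le (switchPotential_nonpos (by omega) H.1 H.2 l))
    rw [collapsePotential, if_pos hs, add_zero]
    exact hmin.trans hc
  · rw [collapsePotential, if_neg hs, ← min_add_add_left]
    exact min_le_min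
      (switchPotential_le_step hg (by omega) le_rfl h l s fun _ => hs)
      (switchPotential_le_step hg (by omega) le_rfl h.swap l s fun _ => hs.symm)

theorem Bact_lineState {g : ℕ} (hg : 0 < g) {L : ℤ} (h₁ : 1 - 6 * (g : ℤ) ≤ L)
    (h₂ : L ≤ 6 * g) (w : List Bool) :
    Bact (6 * g) (lineState L) w = lineState (w.foldl (lineStep g) L) := by
  induction w generalizing L with
  | nil => rfl
  | cons s w ih =>
    have hm := lineStep_mem (by exact_mod_cast hg) h₁ h₂ s
    rw [List.foldl_cons, ← ih hm.1 hm.2, ← Bstep_lineState hg h₁ h₂]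
    rfl

theorem AdmissiblePair.foldl {g P Q : ℤ} (hg : 0 < g) (h : AdmissiblePair g P Q)
    (w : List Bool) : AdmissiblePair g (w.foldl (lineStep g) P) (w.foldl (lineStep g) Q) := by
  induction w generalizing P Q with
  | nil => exact h
  | cons s w ih => exact ih (h.step hg s)

/-- A potential that decreases by at most one at every switch, and not at all at other symbols,
bounds the switch count of a word leading to a pair of potential at most zero. -/
theorem le_swc_of_potential {g : ℤ} (hg : 0 < g) (φ : ℤ → ℤ → Bool → ℤ)
    (hφ : ∀ P Q l s, AdmissiblePair g P Q →
      φ P Q l ≤ (if l = s then 0 else 1) + φ (lineStep g P s) (lineStep g Q s) s)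
    (w : List Bool) {P Q : ℤ} (h : AdmissiblePair g P Q) (l : Bool)
    (hw : ∀ t, φ (w.foldl (lineStep g) P) (w.foldl (lineStep g) Q) t ≤ 0) :
    φ P Q l ≤ swc w := by
  suffices H : ∀ l, φ P Q l ≤ swc (l :: w) - 1 by
    cases w with
    | nil => simpa [swc] using hw l
    | cons s w =>
      have := H l
      rw [swc] at this
      split_ifs at this <;> push_cast at this <;> omega
  clear l
  induction w generalizing P Q with
  | nil => intro l; simpa [swc] using hw l
  | cons s w ih =>
    intro l
    have h₁ := hφ P Q l s h
    have h₂ := ih (h.step hg s) hw s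
    rw [swc]
    split_ifs at h₁ ⊢ <;> push_cast <;> omega

theorem exists_lineState_of_mem_SetC {g : ℕ} {q : ℤ} (hq : q ∈ SetC (6 * g)) :
    ∃ X : ℤ, q = lineState (2 * X) ∧ 1 - (g : ℤ) ≤ X ∧ X ≤ 3 * g := by
  obtain ⟨hq₁, hq₂⟩ := hq
  simp only [SetS, Set.mem_ofPred_eq] at hq₁
  push_cast at hq₁ hq₂
  refine ⟨(q + 1) / 2, ?_, by omega, by omega⟩
  simp only [lineState]
  split_ifs <;> omega

/-- Lower bounds on the switch count of words increasing the distance of a pair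
of states of `C` in `ℬ_n` (`n` divisible by 6). (1) For `2 ≤ k ≤ 2n/3 - 2`:
if `d(p,q) ≤ k - 1` and `d(pw,qw) = k + 1`, then `|w|_s ≥ 2n/3 + 2k - 1` when
`2 ≤ k ≤ n/3`, and `|w|_s ≥ 2n - 2k + 1` when `n/3 + 1 ≤ k ≤ 2n/3 - 2`.
(2) For `k = 2n/3 - 1`: if `d(p,q) = k - 1` and `d(pw,qw) = k + 1`, then
`|w|_s ≥ 2n - 2k + 1`. -/
theorem pair_dist_swc (n : ℕ) (hn : 6 ∣ n) (w : List Bool) (p q : ℤ)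
    (hp : p ∈ SetC n) (hq : q ∈ SetC n) :
    (∀ k : ℕ, 2 ≤ k → k ≤ 2 * n / 3 - 2 →
      dB n p q ≤ k - 1 → dB n (Bact n p w) (Bact n q w) = k + 1 →
      (k ≤ n / 3 → 2 * n / 3 + 2 * k - 1 ≤ swc w) ∧
      (n / 3 + 1 ≤ k → 2 * n - 2 * k + 1 ≤ swc w)) ∧
    (dB n p q = (2 * n / 3 - 1) - 1 →
      dB n (Bact n p w) (Bact n q w) = (2 * n / 3 - 1) + 1 →
      2 * n - 2 * (2 * n / 3 - 1) + 1 ≤ swc w) := by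
  obtain ⟨g, rfl⟩ := hn
  obtain ⟨X, rfl, hX₁, hX₂⟩ := exists_lineState_of_mem_SetC hp
  obtain ⟨Z, rfl, hZ₁, hZ₂⟩ := exists_lineState_of_mem_SetC hq
  have hg : 0 < g := by omega
  have hg' : (0 : ℤ) < g := by omega
  have hadm : AdmissiblePair g (2 * X) (2 * Z) := by constructor <;> omega
  have hadm' := hadm.foldl hg' w
  have hd := hadm.two_mul_dB hg
  have hd' := hadm'.two_mul_dB hg
  have hle := hadm'.sub_le
  have hge := hadm'.le_sub
  rw [Bact_lineState hg (by omega) (by omega), Bact_lineState hg (by omega) (by omega)]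
  constructor
  · intro k hk₁ hk₂ hk₃ hk₄
    rw [hk₄] at hd'
    push_cast at hd'
    have key := le_swc_of_potential hg' (switchPotential g k)
      (fun P Q l s h => switchPotential_le_step hg' (by omega) (by omega) h l s (by omega)) w hadm
      false fun t => by
        unfold switchPotential
        split_ifs at hd' ⊢ <;> omega
    have hstart : switchPotential g k (2 * X) (2 * Z) false = switchBound g k := by
      unfold switchPotential switchCap
      simp only [Bool.false_eq_true, if_false, sub_zero]
      split_ifs at hd ⊢ <;> omega
    rw [hstart, switchBound] at key
    omega
  · intro hk₃ hk₄
    rw [hk₄] at hd'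
    set k : ℤ := 4 * g - 1 with hk
    have key := le_swc_of_potential hg' (collapsePotential g)
      (fun P Q l s h => collapsePotential_le_step hg' h l s) w hadm
      false fun t => by
        rw [collapsePotential, if_pos]
        split_ifs at hd' <;> omega
    have hstart : switchPotential g k (2 * X) (2 * Z) false = switchBound g k := by
      unfold switchPotential switchCap
      simp only [Bool.false_eq_true, if_false, sub_zero]
      split_ifs at hd ⊢ <;> omega
    have hstart' : switchPotential g k (2 * Z) (2 * X) false = switchBound g k := by
      unfold switchPotential switchCap
      simp only [Bool.false_eq_true, if_false, sub_zero]
      split_ifs at hd ⊢ <;> omega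
    rw [collapsePotential, if_neg (by split_ifs at hd <;> omega), hstart, hstart',
      switchBound] at key
    omega
end
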